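/- arXiv:1903.06817 — 3 statements merged into one kernel-verified Lean document; each statement's English description precedes it below -/
import Mathlib

section
/- For every n ≥ 1 and every permutation σ ∈ S_n, there exists a permutation τ ∈ S_n with orderOf τ = orderOf σ such that every cycle length of τ (i.e., every element of its cycle type) is a prime power. Consequently the maximal order of an element of S_n equals the maximal order over elements of S_n all of whose cycle lengths are prime powers. -/
open scoped Classical

/-- `g n` is the maximal order of an element of the symmetric group on `n` letters. -/
noncomputable def g (n : ℕ) : ℕ :=
  Finset.univ.sup (fun σ : Equiv.Perm (Fin n) => orderOf σ)

theorem Nat.exists_isPrimePow_multiset_lcm_eq (a : ℕ) (ha : a ≠ 0) :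
    ∃ s : Multiset ℕ, (∀ c ∈ s, IsPrimePow c) ∧ s.lcm = a ∧ s.sum ≤ a := by
  induction a using Nat.recOnPosPrimePosCoprime with
  | prime_pow p k hp hk =>
    exact ⟨{p ^ k}, by simpa using hp.prime.isPrimePow.pow hk.ne', by simp, by simp⟩
  | zero => exact absurd rfl ha
  | one => exact ⟨0, by simp, by simp, by simp⟩
  | coprime a b ha1 hb1 hab iha ihb =>
    obtain ⟨s, hs, hsl, hss⟩ := iha (by omega)
    obtain ⟨t, ht, htl, hts⟩ := ihb (by omega)
    refine ⟨s + t, fun c hc => ?_, ?_, ?_⟩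
    · exact (Multiset.mem_add.mp hc).elim (hs c) (ht c)
    · rw [Multiset.lcm_add, hsl, htl]
      exact hab.lcm_eq_mul
    · rw [Multiset.sum_add]
      nlinarith

theorem Multiset.exists_isPrimePow_lcm_eq (m : Multiset ℕ) (hm : ∀ a ∈ m, a ≠ 0) :
    ∃ s : Multiset ℕ, (∀ c ∈ s, IsPrimePow c) ∧ s.lcm = m.lcm ∧ s.sum ≤ m.sum := by
  induction m using Multiset.induction_on with
  | empty => exact ⟨0, by simp, rfl, le_rfl⟩
  | cons a m ih =>
    obtain ⟨s, hs, hsl, hss⟩ :=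
      Nat.exists_isPrimePow_multiset_lcm_eq a (hm a (Multiset.mem_cons_self a m))
    obtain ⟨t, ht, htl, hts⟩ := ih fun b hb => hm b (Multiset.mem_cons_of_mem hb)
    refine ⟨s + t, fun c hc => ?_, ?_, ?_⟩
    · exact (Multiset.mem_add.mp hc).elim (hs c) (ht c)
    · rw [Multiset.lcm_add, hsl, htl, Multiset.lcm_cons]
    · rw [Multiset.sum_add, Multiset.sum_cons]
      exact add_le_add hss hts

theorem Equiv.Perm.exists_orderOf_eq_isPrimePow_cycleType {α : Type*} [Fintype α] [DecidableEq α]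
    (σ : Equiv.Perm α) :
    ∃ τ : Equiv.Perm α, orderOf τ = orderOf σ ∧ ∀ c ∈ τ.cycleType, IsPrimePow c := by
  obtain ⟨s, hs, hsl, hss⟩ := Multiset.exists_isPrimePow_lcm_eq σ.cycleType fun a ha =>
    (zero_lt_two.trans_le (Equiv.Perm.two_le_of_mem_cycleType ha)).ne'
  obtain ⟨τ, rfl⟩ := (Equiv.Perm.exists_with_cycleType_iff α (m := s)).mpr
    ⟨hss.trans (σ.sum_cycleType ▸ Finset.card_le_univ _), fun a ha => (hs a ha).two_le⟩
  exact ⟨τ, by rw [← τ.lcm_cycleType, ← σ.lcm_cycleType, hsl], hs⟩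

theorem exists_primePow_cycleType_of_same_order (n : ℕ) (hn : 1 ≤ n) :
    (∀ σ : Equiv.Perm (Fin n), ∃ τ : Equiv.Perm (Fin n),
      orderOf τ = orderOf σ ∧ ∀ c ∈ τ.cycleType, IsPrimePow c) ∧
    g n = (Finset.univ.filter
        (fun σ : Equiv.Perm (Fin n) => ∀ c ∈ σ.cycleType, IsPrimePow c)).sup
      (fun σ => orderOf σ) := by
  refine ⟨fun σ => σ.exists_orderOf_eq_isPrimePow_cycleType, le_antisymm ?_ ?_⟩
  · refine Finset.sup_le fun σ _ => ?_
    obtain ⟨τ, hτ, hc⟩ := σ.exists_orderOf_eq_isPrimePow_cycleType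
    rw [← hτ]
    exact Finset.le_sup (f := fun σ : Equiv.Perm (Fin n) => orderOf σ)
      (Finset.mem_filter.mpr ⟨Finset.mem_univ τ, hc⟩)
  · exact Finset.sup_mono (Finset.filter_subset _ _)
end

section
/- (Lemma 1, Nicolas) Let n ≥ 1 and let p, p', q be pairwise distinct primes with q ≥ p + p'. If q divides g(n), then at least one of p and p' divides g(n). -/
/-- A prime dividing the least common multiple of a multiset divides one of its elements. -/
theorem Nat.Prime.exists_mem_dvd_of_dvd_lcm {q : ℕ} (hq : q.Prime) (m : Multiset ℕ)
    (h : q ∣ m.lcm) : ∃ c ∈ m, q ∣ c := by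
  induction m using Multiset.induction with
  | empty => exact absurd (by simpa using h) hq.ne_one
  | cons a s ih =>
    rw [Multiset.lcm_cons] at h
    rcases hq.dvd_mul.1 (h.trans (lcm_dvd_mul a s.lcm)) with h | h
    · exact ⟨a, by simp, h⟩
    · obtain ⟨c, hc, hqc⟩ := ih h
      exact ⟨c, by simp [hc], hqc⟩

theorem exists_orderOf_eq_g (n : ℕ) : ∃ σ : Equiv.Perm (Fin n), orderOf σ = g n := by
  obtain ⟨σ, -, h⟩ := Finset.exists_mem_eq_sup Finset.univ Finset.univ_nonempty
    (fun σ : Equiv.Perm (Fin n) => orderOf σ)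
  exact ⟨σ, h.symm⟩

theorem orderOf_le_g {n : ℕ} (σ : Equiv.Perm (Fin n)) : orderOf σ ≤ g n :=
  Finset.le_sup (f := fun σ : Equiv.Perm (Fin n) => orderOf σ) (Finset.mem_univ σ)

theorem lcm_le_g {n : ℕ} {m : Multiset ℕ} (hsum : m.sum ≤ n) (htwo : ∀ a ∈ m, 2 ≤ a) :
    m.lcm ≤ g n := by
  obtain ⟨σ, hσ⟩ := (Equiv.Perm.exists_with_cycleType_iff (α := Fin n) (m := m)).2
    ⟨by simpa using hsum, htwo⟩
  rw [← hσ, Equiv.Perm.lcm_cycleType]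
  exact orderOf_le_g σ

/-- If `p + p' ≤ q`, some power of the smaller prime `p` satisfies `p ^ a + p' ≤ q < p ^ a * p'`. -/
theorem exists_pow_add_le_lt_pow_mul {p p' q : ℕ} (hp : p.Prime) (hp' : p'.Prime) (hq : q.Prime)
    (hlt : p < p') (hge : p + p' ≤ q) :
    ∃ a ≠ 0, p ^ a + p' ≤ q ∧ q < p ^ a * p' := by
  have h2 := hp.two_le
  set a := Nat.log p (q - p') with ha
  have ha0 : a ≠ 0 := (Nat.log_pos hp.one_lt (by omega)).ne'
  have hle : p ^ a ≤ q - p' := Nat.pow_log_le_self p (by omega)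
  have hgt : q - p' < p ^ (a + 1) := Nat.lt_pow_succ_log_self hp.one_lt _
  refine ⟨a, ha0, by omega, ?_⟩
  have hpx : p ≤ p ^ a := Nat.le_self_pow ha0 p
  rw [pow_succ] at hgt
  generalize p ^ a = x at *
  have hq' : q < x * p + p' := by omega
  obtain ⟨d, rfl⟩ := Nat.exists_eq_add_of_lt hlt
  by_cases hx : p + d + 1 ≤ x * (d + 1)
  · nlinarith
  · have hd : d = 0 := by
      by_contra hd
      have : 1 ≤ d := by omega
      nlinarith
    subst hd
    have hxp : x = p := by omega
    subst hxp
    rcases Nat.lt_or_ge x 3 with h3 | h3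
    · have : x = 2 := by omega
      subst this
      have : q ≠ 6 := by rintro rfl; norm_num at hq
      omega
    · have h_odd := hp.eq_two_or_odd
      have h_odd' := hp'.eq_two_or_odd
      omega

/-- In an element of maximal order, a cycle of length divisible by `q` cannot be traded for
cycles of lengths `x` and `y` that are coprime to each other and to the order. -/
theorem mul_le_of_add_le_of_dvd_g {n q x y : ℕ} (hq : q.Prime) (hdvd : q ∣ g n)
    (hx : 2 ≤ x) (hy : 2 ≤ y) (hxy : x.Coprime y) (hxg : x.Coprime (g n))
    (hyg : y.Coprime (g n)) (hadd : x + y ≤ q) : x * y ≤ q := by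
  obtain ⟨σ, hσ⟩ := exists_orderOf_eq_g n
  have hpos : 0 < g n := hσ ▸ orderOf_pos σ
  have hlcm : σ.cycleType.lcm = g n := σ.lcm_cycleType.trans hσ
  obtain ⟨c, hc, k, rfl⟩ := hq.exists_mem_dvd_of_dvd_lcm σ.cycleType (hlcm ▸ hdvd)
  obtain ⟨r, hr⟩ := Multiset.exists_cons_of_mem hc
  have htwo : ∀ a ∈ r, 2 ≤ a := fun a ha =>
    Equiv.Perm.two_le_of_mem_cycleType (σ := σ) (by simp [hr, ha])
  have hk : 0 < k :=
    Nat.pos_of_mul_pos_left (Nat.zero_lt_of_lt (Equiv.Perm.two_le_of_mem_cycleType hc))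
  have hsum : q * k + r.sum ≤ n := by simpa [hr] using σ.sum_cycleType_le
  have key : ∀ s : Multiset ℕ, (∀ a ∈ s, 2 ≤ a) → s.sum ≤ n → r ≤ s → k ∣ s.lcm → x ∈ s →
      y ∈ s → x * y ≤ q := by
    intro s hs hsn hrs hks hxs hys
    have hg : g n ∣ q * s.lcm := by
      rw [← hlcm, hr, Multiset.lcm_cons]
      exact lcm_dvd (mul_dvd_mul_left q hks)
        ((Multiset.lcm_mono (Multiset.subset_of_le hrs)).trans (dvd_mul_left _ _))
    have hxyg : x * y * g n ∣ q * s.lcm :=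
      (Nat.Coprime.mul_left hxg hyg).mul_dvd_of_dvd_of_dvd
        ((hxy.mul_dvd_of_dvd_of_dvd (Multiset.dvd_lcm hxs) (Multiset.dvd_lcm hys)).trans
          (dvd_mul_left _ _)) hg
    have hs0 : 0 < s.lcm := Nat.pos_of_ne_zero fun h => by
      have := hs 0 ((Multiset.lcm_eq_zero_iff s).1 h)
      omega
    have hle := Nat.le_of_dvd (Nat.mul_pos hq.pos hs0) hxyg
    exact Nat.le_of_mul_le_mul_right
      (hle.trans (Nat.mul_le_mul_left q (lcm_le_g hsn hs))) hpos
  rcases Nat.lt_or_ge 1 k with hk1 | hk1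
  · refine key (k ::ₘ x ::ₘ y ::ₘ r) ?_ ?_ ?_ (Multiset.dvd_lcm (by simp)) (by simp) (by simp)
    · simpa using ⟨hk1, hx, hy, htwo⟩
    · have : k + q ≤ q * k := by nlinarith [hq.two_le]
      simp only [Multiset.sum_cons]
      omega
    · exact ((Multiset.le_cons_self _ _).trans (Multiset.le_cons_self _ _)).trans
        (Multiset.le_cons_self _ _)
  · obtain rfl : k = 1 := by omega
    refine key (x ::ₘ y ::ₘ r) ?_ ?_ ?_ (one_dvd _) (by simp) (by simp)
    · simpa using ⟨hx, hy, htwo⟩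
    · simp only [Multiset.sum_cons]
      omega
    · exact (Multiset.le_cons_self _ _).trans (Multiset.le_cons_self _ _)

theorem dvd_g_or_dvd_g_of_lt {n p p' q : ℕ} (hp : p.Prime) (hp' : p'.Prime) (hq : q.Prime)
    (hlt : p < p') (hge : p + p' ≤ q) (hdvd : q ∣ g n) : p ∣ g n ∨ p' ∣ g n := by
  by_contra! h
  obtain ⟨a, ha, hadd, hmul⟩ := exists_pow_add_le_lt_pow_mul hp hp' hq hlt hge
  refine hmul.not_ge (mul_le_of_add_le_of_dvd_g hq hdvd
    (hp.two_le.trans (Nat.le_self_pow ha p)) hp'.two_le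
    (((Nat.coprime_primes hp hp').2 hlt.ne).pow_left a)
    ((hp.coprime_iff_not_dvd.2 h.1).pow_left a) (hp'.coprime_iff_not_dvd.2 h.2) hadd)

theorem nicolas_lemma (n : ℕ) (hn : 1 ≤ n) (p p' q : ℕ)
    (hp : p.Prime) (hp' : p'.Prime) (hq : q.Prime)
    (hpp' : p ≠ p') (hpq : p ≠ q) (hp'q : p' ≠ q)
    (hge : p + p' ≤ q) (hdvd : q ∣ g n) :
    p ∣ g n ∨ p' ∣ g n := by
  rcases hpp'.lt_or_gt with h | h
  · exact dvd_g_or_dvd_g_of_lt hp hp' hq h hge hdvd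
  · exact (dvd_g_or_dvd_g_of_lt hp' hp hq h (by omega) hdvd).symm
end

section
/- For every integer n > 500000, letting q denote the largest prime dividing g(n), the number of primes p < 0.8357·q that do not divide g(n) is at most ten; moreover each such prime is at most (1+α)·q/2 for some α ∈ {0, 0.2426, 0.3746, 0.4632, 0.5248, 0.57, 0.6044, 0.6312, 0.6534, 0.6714}. -/
/-- The weighted sum of residues `∑ a * (y % d)` over the pairs `(d, a)` of a list. -/
def residueSum (L : List (ℕ × ℕ)) (y : ℕ) : ℕ := (L.map fun p => p.2 * (y % p.1)).sum

/-- The sum of the weights `c` over the pairs `(j, c)` of a list with `j ≤ y`. -/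
def stepSum (L : List (ℕ × ℕ)) (y : ℕ) : ℕ := (L.map fun p => if p.1 ≤ y then p.2 else 0).sum

/-- The values `f 0, …, f (Y - 1)` written as the digits of one number in base `2 ^ k`. -/
def packed (k : ℕ) (f : ℕ → ℕ) (Y : ℕ) : ℕ := ∑ y ∈ Finset.range Y, f y * 2 ^ (k * y)

/-- Closed form of `packed k 1 n`. -/
def packedOnes (k n : ℕ) : ℕ := (2 ^ (k * n) - 1) / (2 ^ k - 1)

/-- Computable form of `packed k id n`. -/
def packedId (k : ℕ) : ℕ → ℕ
  | 0 => 0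
  | n + 1 => packedId k n + n * 2 ^ (k * n)

/-- Closed form of `packed k (· % d) Y`. -/
def packedMod (k d Y : ℕ) : ℕ :=
  packedId k d * packedOnes (k * d) (Y / d) + 2 ^ (k * (d * (Y / d))) * packedId k (Y % d)

/-- Closed form of the packed indicator function of `j ≤ y`. -/
def packedStep (k j Y : ℕ) : ℕ := 2 ^ (k * j) * packedOnes k (Y - j)

/-- Closed form of the packed function `residueSum L + stepSum c`. -/
def packedSum (k Y : ℕ) (L c : List (ℕ × ℕ)) : ℕ :=
  (L.map fun p => p.2 * packedMod k p.1 Y).sum + (c.map fun p => p.2 * packedStep k p.1 Y).sum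

/-- An upper bound for `residueSum L + stepSum c`. -/
def sumBound (L c : List (ℕ × ℕ)) : ℕ :=
  (L.map fun p => p.2 * (p.1 - 1)).sum + (c.map fun p => p.2).sum

/-- Decides `residueSum P y + stepSum r y ≤ residueSum Q y + stepSum s y` for all `y` at once:
the values at `y < Y` are compared as digits in base `2 ^ k`, those at `y ≥ Y` by `sumBound`. -/
def residueCheck (k Y : ℕ) (P r Q s : List (ℕ × ℕ)) : Bool :=
  decide (0 < k) && P.all (fun p => decide (0 < p.1)) && Q.all (fun p => decide (0 < p.1)) &&
  decide (sumBound P r < 2 ^ (k - 1)) && decide (sumBound Q s < 2 ^ (k - 1)) &&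
  s.all (fun p => decide (p.1 ≤ Y)) && decide (sumBound P r ≤ (s.map fun p => p.2).sum) &&
  decide ((packedSum k Y Q s + 2 ^ (k - 1) * packedOnes k Y - packedSum k Y P r) &&&
    (2 ^ (k - 1) * packedOnes k Y) = 2 ^ (k - 1) * packedOnes k Y)

theorem packedOnes_eq {k : ℕ} (hk : 0 < k) (n : ℕ) :
    packedOnes k n = ∑ y ∈ Finset.range n, 2 ^ (k * y) := by
  have h2 : 2 ≤ 2 ^ k := by
    calc 2 = 2 ^ 1 := rfl
      _ ≤ 2 ^ k := Nat.pow_le_pow_right (by norm_num) hk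
  simp only [packedOnes, pow_mul]
  exact (Nat.geomSum_eq h2 n).symm

theorem packedId_eq (k n : ℕ) : packedId k n = packed k id n := by
  induction n with
  | zero => rfl
  | succ n ih => simp [packedId, packed, Finset.sum_range_succ, ih]

theorem packed_add (k : ℕ) (f : ℕ → ℕ) (m n : ℕ) :
    packed k f (m + n) = packed k f m + 2 ^ (k * m) * packed k (fun y => f (m + y)) n := by
  simp only [packed, Finset.sum_range_add, Finset.mul_sum]
  congr 1
  refine Finset.sum_congr rfl fun y _ => ?_
  rw [mul_add, pow_add]; ring

theorem packed_congr {k : ℕ} {f g : ℕ → ℕ} {Y : ℕ} (h : ∀ y < Y, f y = g y) :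
    packed k f Y = packed k g Y :=
  Finset.sum_congr rfl fun y hy => by rw [h y (Finset.mem_range.1 hy)]

theorem packedMod_eq {k d : ℕ} (hk : 0 < k) (hd : 0 < d) (Y : ℕ) :
    packedMod k d Y = packed k (· % d) Y := by
  have h_period : ∀ m r, r ≤ d → packed k (· % d) (d * m + r) =
      packed k (· % d) (d * m) + 2 ^ (k * (d * m)) * packedId k r := by
    intro m r hr
    rw [packed_add, packedId_eq]
    congr 2
    refine packed_congr fun y hy => ?_
    simp [Nat.mod_eq_of_lt (hy.trans_le hr)]
  have h_mul : ∀ m, packed k (· % d) (d * m) = packedId k d * packedOnes (k * d) m := by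
    intro m
    induction m with
    | zero => simp [packed, packedOnes]
    | succ m ih =>
      rw [packedOnes_eq (Nat.mul_pos hk hd)] at ih ⊢
      rw [mul_add, mul_one, h_period m d le_rfl, ih, Finset.sum_range_succ]
      ring
  conv_rhs => rw [← Nat.div_add_mod Y d]
  rw [h_period _ _ (Nat.mod_lt _ hd).le, h_mul, packedMod]

theorem packedStep_eq {k : ℕ} (hk : 0 < k) (j Y : ℕ) :
    packedStep k j Y = packed k (fun y => if j ≤ y then 1 else 0) Y := by
  rw [packedStep, packedOnes_eq hk]
  have h_zero : ∀ n ≤ j, packed k (fun y => if j ≤ y then 1 else 0) n = 0 := fun n hn =>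
    Finset.sum_eq_zero fun y hy => by
      simp [(Finset.mem_range.1 hy).trans_le hn]
  rcases le_total Y j with h | h
  · simp [h_zero Y h, Nat.sub_eq_zero_of_le h]
  · obtain ⟨n, rfl⟩ := Nat.exists_eq_add_of_le h
    rw [packed_add, h_zero j le_rfl]
    simp [packed]

theorem packed_fun_add (k : ℕ) (f g : ℕ → ℕ) (Y : ℕ) :
    packed k (fun y => f y + g y) Y = packed k f Y + packed k g Y := by
  simp [packed, add_mul, Finset.sum_add_distrib]

theorem packed_const_mul (k a : ℕ) (f : ℕ → ℕ) (Y : ℕ) :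
    packed k (fun y => a * f y) Y = a * packed k f Y := by
  simp [packed, mul_assoc, Finset.mul_sum]

theorem packedSum_eq {k : ℕ} (hk : 0 < k) (Y : ℕ) {L : List (ℕ × ℕ)} (hL : ∀ p ∈ L, 0 < p.1)
    (c : List (ℕ × ℕ)) :
    packedSum k Y L c = packed k (fun y => residueSum L y + stepSum c y) Y := by
  rw [packed_fun_add, packedSum]
  congr 1
  · induction L with
    | nil => simp [residueSum, packed]
    | cons p L ih =>
      have := ih fun q hq => hL q (List.mem_cons_of_mem _ hq)
      have h_cons : residueSum (p :: L) = fun y => p.2 * (y % p.1) + residueSum L y := rfl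
      rw [h_cons, packed_fun_add, ← this, packed_const_mul,
        ← packedMod_eq hk (hL p List.mem_cons_self), List.map_cons, List.sum_cons]
  · induction c with
    | nil => simp [stepSum, packed]
    | cons p c ih =>
      have h_cons : stepSum (p :: c) = fun y => p.2 * (if p.1 ≤ y then 1 else 0) + stepSum c y := by
        funext y
        simp [stepSum]
      rw [h_cons, packed_fun_add, ← ih, packed_const_mul, ← packedStep_eq hk, List.map_cons,
        List.sum_cons]

theorem residueSum_add_stepSum_le {L : List (ℕ × ℕ)} (hL : ∀ p ∈ L, 0 < p.1)
    (c : List (ℕ × ℕ)) (y : ℕ) : residueSum L y + stepSum c y ≤ sumBound L c := by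
  refine Nat.add_le_add (List.sum_le_sum fun p hp => ?_) (List.sum_le_sum fun p hp => ?_)
  · have := Nat.mod_lt y (hL p hp)
    exact Nat.mul_le_mul_left _ (by omega)
  · split_ifs <;> simp

theorem packed_lt {k : ℕ} {f : ℕ → ℕ} (hf : ∀ y, f y < 2 ^ k) (Y : ℕ) :
    packed k f Y < 2 ^ (k * Y) := by
  induction Y with
  | zero => simp [packed]
  | succ Y ih =>
    rw [packed, Finset.sum_range_succ, ← packed, mul_add, mul_one, pow_add]
    have := hf Y
    have := Nat.two_pow_pos (k * Y)
    nlinarith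

theorem testBit_packed {k : ℕ} {f : ℕ → ℕ} (hf : ∀ y, f y < 2 ^ k) {Y y i : ℕ} (hy : y < Y)
    (hi : i < k) : (packed k f Y).testBit (k * y + i) = (f y).testBit i := by
  induction Y with
  | zero => omega
  | succ Y ih =>
    rw [packed, Finset.sum_range_succ, ← packed, add_comm, mul_comm (f Y),
      Nat.testBit_two_pow_mul_add _ (packed_lt hf Y)]
    rcases Nat.lt_succ_iff_lt_or_eq.1 hy with h | rfl
    · have : k * y + i < k * Y := by nlinarith
      rw [if_pos this, ih h]
    · simp

theorem le_of_residueCheck {k Y : ℕ} {P r Q s : List (ℕ × ℕ)}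
    (h : residueCheck k Y P r Q s = true) (y : ℕ) :
    residueSum P y + stepSum r y ≤ residueSum Q y + stepSum s y := by
  simp only [residueCheck, Bool.and_eq_true, decide_eq_true_eq, List.all_eq_true] at h
  obtain ⟨⟨⟨⟨⟨⟨⟨hk, hP⟩, hQ⟩, hPr⟩, hQs⟩, hs⟩, h_tail⟩, h_bits⟩ := h
  have h_left := residueSum_add_stepSum_le hP r
  have h_right := residueSum_add_stepSum_le hQ s
  rcases le_or_gt Y y with hy | hy
  · refine (h_left y).trans (h_tail.trans (le_add_left ?_))
    refine List.sum_le_sum fun p hp => ?_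
    rw [if_pos ((hs p hp).trans hy)]
  · have h_pow : 2 ^ (k - 1) + 2 ^ (k - 1) = 2 ^ k := by
      rw [← two_mul, ← pow_succ', Nat.sub_add_cancel hk]
    set f : ℕ → ℕ := fun y =>
      (residueSum Q y + stepSum s y + 2 ^ (k - 1)) - (residueSum P y + stepSum r y) with hf
    have h_f : ∀ y, f y < 2 ^ k := fun y => by
      have := h_right y
      simp only [hf]; omega
    have h_ones : 2 ^ (k - 1) * packedOnes k Y = packed k (fun _ => 2 ^ (k - 1)) Y := by
      rw [packedOnes_eq hk, packed, Finset.mul_sum]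
    have h_diff : packedSum k Y Q s + 2 ^ (k - 1) * packedOnes k Y - packedSum k Y P r =
        packed k f Y := by
      rw [h_ones, packedSum_eq hk Y hQ, packedSum_eq hk Y hP, ← packed_fun_add]
      refine Nat.sub_eq_of_eq_add ?_
      rw [← packed_fun_add]
      refine packed_congr fun y _ => ?_
      have := h_left y
      simp only [hf]; omega
    have h_half : (packed k (fun _ => 2 ^ (k - 1)) Y).testBit (k * y + (k - 1)) = true := by
      rw [testBit_packed (fun _ => Nat.pow_lt_pow_right (by norm_num) (by omega)) hy (by omega)]
      simp
    rw [h_diff, h_ones] at h_bits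
    rw [← h_bits, Nat.testBit_and, testBit_packed h_f hy (by omega), Bool.and_eq_true] at h_half
    have := Nat.ge_two_pow_of_testBit h_half.1
    have := h_left y
    simp only [hf] at *
    omega

section PrimeGaps

open ArithmeticFunction Chebyshev

/-- `10 ^ 9` times a lower approximation of `log (k / (k - 1))`. -/
def logStep (k : ℕ) : ℕ :=
  ∑ i ∈ Finset.range 10, 2 * 10 ^ 9 / ((2 * i + 1) * (2 * k - 1) ^ (2 * i + 1))

/-- A lower approximation of `10 ^ 9 * log n`. -/
def logLow : ℕ → ℕ
  | 0 => 0
  | 1 => 0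
  | n + 2 => logLow (n + 1) + logStep (n + 2)

/-- An upper approximation of `10 ^ 9 * log n`. -/
def logUp : ℕ → ℕ
  | 0 => 0
  | 1 => 0
  | n + 2 => logUp (n + 1) + (logStep (n + 2) + 11)

theorem logStep_bounds (n : ℕ) :
    (logStep (n + 2) : ℝ) ≤ 10 ^ 9 * (Real.log (n + 2 : ℕ) - Real.log (n + 1 : ℕ)) ∧
    10 ^ 9 * (Real.log (n + 2 : ℕ) - Real.log (n + 1 : ℕ)) ≤ logStep (n + 2) + 11 := by
  obtain ⟨m, hm⟩ : ∃ m : ℕ, m = 2 * (n + 2) - 1 := ⟨_, rfl⟩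
  have h_cast : (m : ℝ) = 2 * n + 3 := by
    have : m = 2 * n + 3 := by omega
    rw [this]; push_cast; ring
  have hm3 : (3 : ℝ) ≤ m := by rw [h_cast]; linarith [(Nat.cast_nonneg n : (0 : ℝ) ≤ n)]
  set x : ℝ := (m : ℝ)⁻¹ with hx
  have hx0 : 0 ≤ x := by positivity
  have hx3 : x ≤ 1 / 3 := by
    rw [hx, ← one_div]; exact one_div_le_one_div_of_le (by norm_num) hm3
  have h_log : Real.log ((1 + x) / (1 - x)) = Real.log (n + 2 : ℕ) - Real.log (n + 1 : ℕ) := by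
    rw [← Real.log_div (by positivity) (by positivity)]
    congr 1
    rw [hx, h_cast]
    push_cast
    have h1 : (2 * (n : ℝ) + 3) ≠ 0 := by positivity
    have h2 : (n : ℝ) + 1 ≠ 0 := by positivity
    have h3 : 1 - (2 * (n : ℝ) + 3)⁻¹ ≠ 0 := by
      rw [← h_cast, ← hx]; linarith
    rw [div_eq_div_iff h3 (by exact_mod_cast h2)]
    field_simp
    ring
  have h_lower := Real.sum_range_le_log_div hx0 (by linarith) 10
  have h_upper := Real.log_div_le_sum_range_add hx0 (by linarith) 10
  rw [h_log] at h_lower h_upper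
  have h_step : (logStep (n + 2) : ℝ) = ∑ i ∈ Finset.range 10,
      ((2 * 10 ^ 9 / ((2 * i + 1) * m ^ (2 * i + 1)) : ℕ) : ℝ) := by
    rw [logStep, ← hm, Nat.cast_sum]
  have h_term : ∀ i : ℕ, (((2 * 10 ^ 9 / ((2 * i + 1) * m ^ (2 * i + 1)) : ℕ) : ℝ) ≤
      2 * 10 ^ 9 * (x ^ (2 * i + 1) / (2 * i + 1))) ∧
      2 * 10 ^ 9 * (x ^ (2 * i + 1) / (2 * i + 1)) ≤
      ((2 * 10 ^ 9 / ((2 * i + 1) * m ^ (2 * i + 1)) : ℕ) : ℝ) + 1 := by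
    intro i
    have h_eq : 2 * 10 ^ 9 * (x ^ (2 * i + 1) / (2 * i + 1)) =
        ((2 * 10 ^ 9 : ℕ) : ℝ) / (((2 * i + 1) * m ^ (2 * i + 1) : ℕ) : ℝ) := by
      rw [hx, inv_pow]; push_cast
      have : (m : ℝ) ≠ 0 := by linarith
      field_simp
      norm_num
    rw [h_eq]
    exact ⟨Nat.cast_div_le, by
      rw [← Nat.floor_div_eq_div (K := ℝ)]; exact (Nat.lt_floor_add_one _).le⟩
  have h_sum_lower : (logStep (n + 2) : ℝ) ≤
      2 * 10 ^ 9 * ∑ i ∈ Finset.range 10, x ^ (2 * i + 1) / (2 * i + 1) := by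
    rw [h_step, Finset.mul_sum]
    exact Finset.sum_le_sum fun i _ => (h_term i).1
  have h_sum_upper : 2 * 10 ^ 9 * ∑ i ∈ Finset.range 10, x ^ (2 * i + 1) / (2 * i + 1) ≤
      logStep (n + 2) + 10 := by
    rw [h_step, Finset.mul_sum]
    refine (Finset.sum_le_sum fun i _ => (h_term i).2).trans ?_
    rw [Finset.sum_add_distrib]
    simp
  have h_rem : x ^ (2 * 10 + 1) / (1 - x ^ 2) ≤ 1 / (2 * 10 ^ 9) := by
    have h_pow : x ^ 21 ≤ (1 / 3) ^ 21 := pow_le_pow_left₀ hx0 hx3 21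
    have h_sq : x ^ 2 ≤ (1 / 3) ^ 2 := pow_le_pow_left₀ hx0 hx3 2
    have h_pos : 0 < 1 - x ^ 2 := by linarith
    rw [div_le_iff₀ h_pos]
    linarith
  constructor <;> norm_num at * <;> linarith

theorem logLow_le_log_le_logUp {n : ℕ} (hn : 0 < n) :
    (logLow n : ℝ) ≤ 10 ^ 9 * Real.log n ∧ 10 ^ 9 * Real.log n ≤ logUp n := by
  induction n with
  | zero => omega
  | succ n ih =>
    cases n with
    | zero => simp [logLow, logUp]
    | succ n =>
      have h_prev := ih (by omega)
      have h_step := logStep_bounds n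
      simp only [logLow, logUp, Nat.cast_add (R := ℝ), Nat.cast_ofNat (R := ℝ)] at h_prev h_step ⊢
      push_cast at h_prev h_step ⊢
      have h_two : (n : ℝ) + 1 + 1 = n + 2 := by ring
      rw [h_two]
      constructor <;> linarith [h_prev.1, h_prev.2, h_step.1, h_step.2]

theorem sum_vonMangoldt_mul_div (N : ℕ) :
    ∑ n ∈ Finset.Ioc 0 N, Λ n * ((N / n : ℕ) : ℝ) = Real.log (N.factorial : ℝ) := by
  induction N with
  | zero => simp
  | succ N ih =>
    have h_div : ∀ n, Λ n * (((N + 1) / n : ℕ) : ℝ) =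
        Λ n * ((N / n : ℕ) : ℝ) + if n ∣ N + 1 then Λ n else 0 := by
      intro n
      rw [Nat.succ_div]
      split_ifs <;> push_cast <;> ring
    have h_divisors : ∑ n ∈ Finset.Ioc 0 (N + 1), (if n ∣ N + 1 then Λ n else 0) =
        Real.log (N + 1 : ℕ) := by
      rw [← vonMangoldt_sum, ← Finset.sum_filter]
      refine Finset.sum_congr ?_ fun _ _ => rfl
      ext n
      simp only [Finset.mem_filter, Finset.mem_Ioc, Nat.mem_divisors]
      exact ⟨fun h => ⟨h.2, by omega⟩, fun h =>
        ⟨⟨Nat.pos_of_dvd_of_pos h.1 (by omega), Nat.le_of_dvd (by omega) h.1⟩, h.1⟩⟩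
    simp_rw [h_div]
    rw [Finset.sum_add_distrib, h_divisors, Finset.sum_Ioc_succ_top (Nat.zero_le N), ih,
      Nat.div_eq_of_lt (Nat.lt_succ_self N), Nat.factorial_succ, Nat.cast_mul,
      Real.log_mul (by positivity) (by positivity)]
    push_cast
    ring

theorem sum_vonMangoldt_mul_div_of_le {M N : ℕ} (h : M ≤ N) :
    ∑ n ∈ Finset.Ioc 0 N, Λ n * ((M / n : ℕ) : ℝ) = Real.log (M.factorial : ℝ) := by
  rw [← sum_vonMangoldt_mul_div]
  refine (Finset.sum_subset (Finset.Ioc_subset_Ioc_right h) fun n hn hM => ?_).symm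
  simp only [Finset.mem_Ioc] at hn hM
  rw [Nat.div_eq_of_lt (by omega)]
  simp

/-- The combination `∑_{n ≤ N} Λ n * ((N / n) % d)` of log-factorials. -/
noncomputable def logFactorialDiff (d N : ℕ) : ℝ :=
  Real.log (N.factorial : ℝ) - d * Real.log ((N / d).factorial : ℝ)

theorem sum_vonMangoldt_mul_mod (d N : ℕ) :
    ∑ n ∈ Finset.Ioc 0 N, Λ n * ((N / n % d : ℕ) : ℝ) = logFactorialDiff d N := by
  rw [logFactorialDiff, ← sum_vonMangoldt_mul_div, ← sum_vonMangoldt_mul_div_of_le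
    (Nat.div_le_self N d), Finset.mul_sum, ← Finset.sum_sub_distrib]
  refine Finset.sum_congr rfl fun n _ => ?_
  have h := Nat.div_add_mod (N / n) d
  rw [Nat.div_div_eq_div_mul, mul_comm n d, ← Nat.div_div_eq_div_mul] at h
  rw [← h]
  push_cast
  rw [h]
  ring

theorem sum_vonMangoldt_mul_ite {j : ℕ} (hj : 0 < j) (N : ℕ) :
    ∑ n ∈ Finset.Ioc 0 N, Λ n * (((if j ≤ N / n then 1 else 0) : ℕ) : ℝ) = ψ (N / j : ℕ) := by
  rw [psi, Nat.floor_natCast]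
  have h_filter : Finset.Ioc 0 (N / j) = (Finset.Ioc 0 N).filter fun n => j ≤ N / n := by
    ext n
    simp only [Finset.mem_filter, Finset.mem_Ioc]
    constructor
    · rintro ⟨h0, h⟩
      exact ⟨⟨h0, h.trans (Nat.div_le_self _ _)⟩, by
        rw [Nat.le_div_iff_mul_le h0, mul_comm]; exact (Nat.le_div_iff_mul_le hj).1 h⟩
    · rintro ⟨⟨h0, -⟩, h⟩
      exact ⟨h0, by
        rw [Nat.le_div_iff_mul_le hj, mul_comm]; exact (Nat.le_div_iff_mul_le h0).1 h⟩
  rw [h_filter, Finset.sum_filter]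
  refine Finset.sum_congr rfl fun n _ => ?_
  split_ifs <;> simp

/-- The weighted sum `∑ a * f d` over the pairs `(d, a)` of a list. -/
noncomputable def weightedSum (L : List (ℕ × ℕ)) (f : ℕ → ℝ) : ℝ :=
  (L.map fun p => (p.2 : ℝ) * f p.1).sum

theorem weightedSum_cons (p : ℕ × ℕ) (L : List (ℕ × ℕ)) (f : ℕ → ℝ) :
    weightedSum (p :: L) f = p.2 * f p.1 + weightedSum L f := by
  simp [weightedSum]

theorem sum_vonMangoldt_mul_residueSum (L : List (ℕ × ℕ)) (N : ℕ) :
    ∑ n ∈ Finset.Ioc 0 N, Λ n * (residueSum L (N / n) : ℝ) =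
      weightedSum L fun d => logFactorialDiff d N := by
  induction L with
  | nil => simp [residueSum, weightedSum]
  | cons p L ih =>
    have h_cons : ∀ y, residueSum (p :: L) y = p.2 * (y % p.1) + residueSum L y := fun _ => rfl
    rw [weightedSum_cons, ← ih, ← sum_vonMangoldt_mul_mod, Finset.mul_sum,
      ← Finset.sum_add_distrib]
    refine Finset.sum_congr rfl fun n _ => ?_
    rw [h_cons]; push_cast; ring

theorem sum_vonMangoldt_mul_stepSum {c : List (ℕ × ℕ)} (hc : ∀ p ∈ c, 0 < p.1) (N : ℕ) :
    ∑ n ∈ Finset.Ioc 0 N, Λ n * (stepSum c (N / n) : ℝ) =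
      weightedSum c fun j => ψ (N / j : ℕ) := by
  induction c with
  | nil => simp [stepSum, weightedSum]
  | cons p c ih =>
    have h_cons : ∀ y, stepSum (p :: c) y = p.2 * (if p.1 ≤ y then 1 else 0) + stepSum c y :=
      fun y => by simp [stepSum]
    rw [weightedSum_cons, ← ih fun q hq => hc q (List.mem_cons_of_mem _ hq),
      ← sum_vonMangoldt_mul_ite (hc p List.mem_cons_self), Finset.mul_sum,
      ← Finset.sum_add_distrib]
    refine Finset.sum_congr rfl fun n _ => ?_
    rw [h_cons]; push_cast; ring

theorem weightedSum_le_of_residueCheck {k Y : ℕ} {P r Q s : List (ℕ × ℕ)}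
    (h : residueCheck k Y P r Q s = true) (hr : ∀ p ∈ r, 0 < p.1) (hs : ∀ p ∈ s, 0 < p.1)
    (N : ℕ) :
    weightedSum P (fun d => logFactorialDiff d N) + weightedSum r (fun j => ψ (N / j : ℕ)) ≤
      weightedSum Q (fun d => logFactorialDiff d N) + weightedSum s fun j => ψ (N / j : ℕ) := by
  simp only [← sum_vonMangoldt_mul_residueSum, ← sum_vonMangoldt_mul_stepSum hr,
    ← sum_vonMangoldt_mul_stepSum hs, ← Finset.sum_add_distrib, ← mul_add]
  refine Finset.sum_le_sum fun n _ => mul_le_mul_of_nonneg_left ?_ vonMangoldt_nonneg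
  exact_mod_cast le_of_residueCheck h (N / n)

theorem le_log_factorial {n : ℕ} (hn : 0 < n) :
    n * Real.log n - n ≤ Real.log (n.factorial : ℝ) := by
  induction n with
  | zero => omega
  | succ n ih =>
    rcases Nat.eq_zero_or_pos n with rfl | h0
    · simp
    have h_pos : (0 : ℝ) < n := by exact_mod_cast h0
    have h_log : Real.log (n + 1 : ℝ) - Real.log n ≤ 1 / n := by
      rw [← Real.log_div (by positivity) (by positivity)]
      refine (Real.log_le_sub_one_of_pos (by positivity)).trans (le_of_eq ?_)
      field_simp; ring
    have h_mul := mul_le_mul_of_nonneg_left h_log h_pos.le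
    rw [mul_one_div_cancel h_pos.ne'] at h_mul
    rw [Nat.factorial_succ, Nat.cast_mul, Real.log_mul (by positivity) (by positivity)]
    push_cast
    linarith [ih h0]

theorem log_factorial_le {n : ℕ} (hn : 0 < n) :
    Real.log (n.factorial : ℝ) ≤ n * Real.log n - n + Real.log n + 1 := by
  induction n with
  | zero => omega
  | succ n ih =>
    rcases Nat.eq_zero_or_pos n with rfl | h0
    · simp
    have h_pos : (0 : ℝ) < n := by exact_mod_cast h0
    have h_log : 1 - (n : ℝ) / (n + 1) ≤ Real.log (n + 1 : ℝ) - Real.log n := by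
      have := Real.log_le_sub_one_of_pos (show (0 : ℝ) < n / (n + 1) by positivity)
      rw [Real.log_div (by positivity) (by positivity)] at this
      linarith
    have h_eq : ((n : ℝ) + 1) * (1 - (n : ℝ) / (n + 1)) = 1 := by field_simp; ring
    have h_mul := mul_le_mul_of_nonneg_left h_log (by positivity : (0 : ℝ) ≤ n + 1)
    rw [h_eq] at h_mul
    rw [Nat.factorial_succ, Nat.cast_mul, Real.log_mul (by positivity) (by positivity)]
    push_cast
    linarith [ih h0]

theorem mul_log_sub_mono {s t : ℝ} (hs : 1 ≤ s) (hst : s ≤ t) :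
    s * Real.log s - s ≤ t * Real.log t - t := by
  have h_pos : 0 < s := by linarith
  have h_log := Real.log_le_sub_one_of_pos (div_pos h_pos (h_pos.trans_le hst))
  rw [Real.log_div h_pos.ne' (by linarith)] at h_log
  have h_mul := mul_le_mul_of_nonneg_left h_log (by linarith : 0 ≤ t)
  have h_eq : t * (s / t - 1) = s - t := by
    have : t ≠ 0 := by linarith
    field_simp
  have h_ls := Real.log_nonneg hs
  nlinarith

theorem log_factorial_floor_bounds {x y : ℝ} (hx : 1 ≤ x) (hy : 0 < y) (hyx : y ≤ x) :
    y * Real.log y - y - (Real.log x + 1) ≤ Real.log (⌊y⌋₊.factorial : ℝ) ∧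
    Real.log (⌊y⌋₊.factorial : ℝ) ≤ y * Real.log y - y + (Real.log x + 1) := by
  have h_logx := Real.log_nonneg hx
  rcases lt_or_ge y 1 with h1 | h1
  · rw [Nat.floor_eq_zero.2 h1]
    have h_neg := Real.log_nonpos hy.le h1.le
    have h_inv := Real.log_le_sub_one_of_pos (inv_pos.2 hy)
    rw [Real.log_inv] at h_inv
    have h_mul := mul_le_mul_of_nonneg_left h_inv hy.le
    rw [mul_sub, mul_inv_cancel₀ hy.ne'] at h_mul
    simp only [Nat.factorial_zero, Nat.cast_one, Real.log_one]
    constructor <;> nlinarith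
  · set N := ⌊y⌋₊ with hN
    have hN1 : 1 ≤ N := Nat.le_floor (by simpa using h1)
    have hN1' : (1 : ℝ) ≤ N := by exact_mod_cast hN1
    have hNy : (N : ℝ) ≤ y := Nat.floor_le hy.le
    have hyN : y ≤ N + 1 := (Nat.lt_floor_add_one y).le
    have h_log_yx : Real.log y ≤ Real.log x := Real.log_le_log hy hyx
    constructor
    · have h_fact := le_log_factorial (Nat.succ_pos N)
      rw [Nat.succ_eq_add_one, Nat.factorial_succ, Nat.cast_mul,
        Real.log_mul (by positivity) (by positivity)] at h_fact
      push_cast at h_fact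
      have h_mono := mul_log_sub_mono h1 hyN
      have h_log : Real.log (N + 1 : ℝ) ≤ Real.log y + 1 := by
        have h_quot := Real.log_le_sub_one_of_pos (show 0 < ((N : ℝ) + 1) / y by positivity)
        rw [Real.log_div (by positivity) (by positivity)] at h_quot
        have : ((N : ℝ) + 1) / y ≤ 2 := by rw [div_le_iff₀ hy]; linarith
        linarith
      linarith
    · have h_fact := log_factorial_le hN1
      have h_mono := mul_log_sub_mono hN1' hNy
      have h_log := Real.log_le_log (by linarith) hNy
      linarith

theorem logFactorialDiff_bounds {x y : ℝ} (hx : 1 ≤ x) (hy : 0 < y) (hyx : y ≤ x) {d : ℕ}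
    (hd : 0 < d) :
    y * Real.log d - (d + 1) * (Real.log x + 1) ≤ logFactorialDiff d ⌊y⌋₊ ∧
    logFactorialDiff d ⌊y⌋₊ ≤ y * Real.log d + (d + 1) * (Real.log x + 1) := by
  have hd' : (1 : ℝ) ≤ d := by exact_mod_cast hd
  have h_num := log_factorial_floor_bounds hx hy hyx
  have h_den := log_factorial_floor_bounds hx (div_pos hy (by linarith))
    ((div_le_self hy.le hd').trans hyx)
  rw [Nat.floor_div_natCast, Real.log_div hy.ne' (by linarith)] at h_den
  have h_eq : (d : ℝ) * (y / d * (Real.log y - Real.log d) - y / d) =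
      y * (Real.log y - Real.log d) - y := by
    field_simp
  have h_lower := mul_le_mul_of_nonneg_left h_den.1 (by linarith : (0 : ℝ) ≤ d)
  have h_upper := mul_le_mul_of_nonneg_left h_den.2 (by linarith : (0 : ℝ) ≤ d)
  rw [mul_sub, h_eq] at h_lower
  rw [mul_add, h_eq] at h_upper
  rw [logFactorialDiff]
  constructor <;> linarith [h_num.1, h_num.2]

/-- Linear bounds for `ψ` on `(0, x]`, with slopes in units of `10 ^ (-9)` and an error term
of `E * (log x + 1)`. -/
def PsiBound (Am Ap E : ℕ) : Prop :=
  ∀ x : ℝ, 1 ≤ x → ∀ y : ℝ, 0 < y → y ≤ x →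
    Am * y ≤ 10 ^ 9 * (ψ y + E * (Real.log x + 1)) ∧
    10 ^ 9 * ψ y ≤ Ap * y + 10 ^ 9 * (E * (Real.log x + 1))

/-- The slope of a lower bound for `weightedSum L (logFactorialDiff ·) + weightedSum c (ψ ·)`. -/
def slopeLow (L c : List (ℕ × ℕ)) (Am : ℕ) : ℕ :=
  (L.map fun p => p.2 * logLow p.1).sum + (c.map fun p => p.2 * Am / p.1).sum

/-- The slope of an upper bound for `weightedSum L (logFactorialDiff ·) + weightedSum c (ψ ·)`. -/
def slopeUp (L c : List (ℕ × ℕ)) (Ap : ℕ) : ℕ :=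
  (L.map fun p => p.2 * logUp p.1).sum + (c.map fun p => p.2 * Ap / p.1 + 1).sum

/-- The factor of `log x + 1` in the bounds with slopes `slopeLow` and `slopeUp`. -/
def slopeError (L c : List (ℕ × ℕ)) (E : ℕ) : ℕ :=
  (L.map fun p => p.2 * (p.1 + 1)).sum + (c.map fun p => p.2 * E).sum

theorem weightedSum_logFactorialDiff_bounds {x y : ℝ} (hx : 1 ≤ x) (hy : 0 < y) (hyx : y ≤ x)
    {L : List (ℕ × ℕ)} (hL : ∀ p ∈ L, 0 < p.1) :
    ((L.map fun p => p.2 * logLow p.1).sum : ℕ) * y ≤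
      10 ^ 9 * (weightedSum L (fun d => logFactorialDiff d ⌊y⌋₊) +
        ((L.map fun p => p.2 * (p.1 + 1)).sum : ℕ) * (Real.log x + 1)) ∧
    10 ^ 9 * weightedSum L (fun d => logFactorialDiff d ⌊y⌋₊) ≤
      ((L.map fun p => p.2 * logUp p.1).sum : ℕ) * y +
        10 ^ 9 * (((L.map fun p => p.2 * (p.1 + 1)).sum : ℕ) * (Real.log x + 1)) := by
  induction L with
  | nil => simp [weightedSum]
  | cons p L ih =>
    have h_tail := ih fun q hq => hL q (List.mem_cons_of_mem _ hq)
    have h_pos := hL p List.mem_cons_self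
    have h_log := logLow_le_log_le_logUp h_pos
    have h_diff := logFactorialDiff_bounds hx hy hyx h_pos
    have h_cast : (0 : ℝ) ≤ p.2 := Nat.cast_nonneg _
    have h_lower := mul_le_mul_of_nonneg_left h_diff.1 h_cast
    have h_upper := mul_le_mul_of_nonneg_left h_diff.2 h_cast
    have h_low := mul_le_mul_of_nonneg_left h_log.1 (mul_nonneg h_cast hy.le)
    have h_up := mul_le_mul_of_nonneg_left h_log.2 (mul_nonneg h_cast hy.le)
    simp only [List.map_cons, List.sum_cons, weightedSum_cons]
    push_cast at h_tail ⊢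
    constructor <;> linarith [h_tail.1, h_tail.2]

theorem weightedSum_psi_bounds {Am Ap E : ℕ} (h : PsiBound Am Ap E) {x y : ℝ} (hx : 1 ≤ x)
    (hy : 0 < y) (hyx : y ≤ x) {c : List (ℕ × ℕ)} (hc : ∀ p ∈ c, 0 < p.1) :
    ((c.map fun p => p.2 * Am / p.1).sum : ℕ) * y ≤
      10 ^ 9 * (weightedSum c (fun j => ψ (⌊y⌋₊ / j : ℕ)) +
        ((c.map fun p => p.2 * E).sum : ℕ) * (Real.log x + 1)) ∧
    10 ^ 9 * weightedSum c (fun j => ψ (⌊y⌋₊ / j : ℕ)) ≤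
      ((c.map fun p => p.2 * Ap / p.1 + 1).sum : ℕ) * y +
        10 ^ 9 * (((c.map fun p => p.2 * E).sum : ℕ) * (Real.log x + 1)) := by
  induction c with
  | nil => simp [weightedSum]
  | cons p c ih =>
    have h_tail := ih fun q hq => hc q (List.mem_cons_of_mem _ hq)
    have h_pos := hc p List.mem_cons_self
    have h_pos' : (1 : ℝ) ≤ p.1 := by exact_mod_cast h_pos
    have h_psi := h x hx (y / p.1) (div_pos hy (by linarith))
      ((div_le_self hy.le h_pos').trans hyx)
    rw [psi_eq_psi_coe_floor, Nat.floor_div_natCast] at h_psi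
    have h_cast : (0 : ℝ) ≤ p.2 := Nat.cast_nonneg _
    have h_lower := mul_le_mul_of_nonneg_left h_psi.1 h_cast
    have h_upper := mul_le_mul_of_nonneg_left h_psi.2 h_cast
    have h_low : ((p.2 * Am / p.1 : ℕ) : ℝ) * y ≤ p.2 * (Am * (y / p.1)) := by
      refine (mul_le_mul_of_nonneg_right Nat.cast_div_le hy.le).trans (le_of_eq ?_)
      push_cast; ring
    have h_up : (p.2 : ℝ) * (Ap * (y / p.1)) ≤ ((p.2 * Ap / p.1 : ℕ) + 1 : ℝ) * y := by
      have := mul_le_mul_of_nonneg_right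
        (Nat.lt_floor_add_one (((p.2 * Ap : ℕ) : ℝ) / p.1)).le hy.le
      rw [Nat.floor_div_eq_div] at this
      refine (le_of_eq ?_).trans this
      push_cast; ring
    simp only [List.map_cons, List.sum_cons, weightedSum_cons]
    push_cast at h_tail h_low h_up ⊢
    constructor <;> linarith [h_tail.1, h_tail.2]

theorem slope_bounds {Am Ap E : ℕ} (h : PsiBound Am Ap E) {x y : ℝ} (hx : 1 ≤ x)
    (hy : 0 < y) (hyx : y ≤ x) {L c : List (ℕ × ℕ)} (hL : ∀ p ∈ L, 0 < p.1)
    (hc : ∀ p ∈ c, 0 < p.1) :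
    slopeLow L c Am * y ≤ 10 ^ 9 * (weightedSum L (fun d => logFactorialDiff d ⌊y⌋₊) +
      weightedSum c (fun j => ψ (⌊y⌋₊ / j : ℕ)) + slopeError L c E * (Real.log x + 1)) ∧
    10 ^ 9 * (weightedSum L (fun d => logFactorialDiff d ⌊y⌋₊) +
      weightedSum c (fun j => ψ (⌊y⌋₊ / j : ℕ))) ≤
      slopeUp L c Ap * y + 10 ^ 9 * (slopeError L c E * (Real.log x + 1)) := by
  have h_diff := weightedSum_logFactorialDiff_bounds hx hy hyx hL
  have h_psi := weightedSum_psi_bounds h hx hy hyx hc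
  rw [slopeLow, slopeUp, slopeError]
  simp only [Nat.cast_add]
  constructor <;> linarith [h_diff.1, h_diff.2, h_psi.1, h_psi.2]

/-- Decides that the certificates `(P, r, Q, s)` and `(P', r', Q', s')` improve the bounds
`PsiBound Am Ap E` to `PsiBound Bm Bp F`. -/
def improveCheck (Am Ap E Bm Bp F S S' : ℕ) (P r Q s P' r' Q' s' : List (ℕ × ℕ)) : Bool :=
  (P ++ r ++ Q ++ s ++ P' ++ r' ++ Q' ++ s').all (fun p => decide (0 < p.1)) &&
  decide (0 < S) && decide (0 < S') &&
  decide (slopeUp Q s Ap + S * Bm ≤ slopeLow P r Am) &&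
  decide (slopeError P r E + slopeError Q s E ≤ S * F) &&
  decide (slopeUp Q' s' Ap ≤ slopeLow P' r' Am + S' * Bp) &&
  decide (slopeError P' r' E + slopeError Q' s' E ≤ S' * F)

theorem PsiBound.improve {Am Ap E Bm Bp F S S' k Y : ℕ} {P r Q s P' r' Q' s' : List (ℕ × ℕ)}
    (h : PsiBound Am Ap E) (h_lower : residueCheck k Y P r Q ((1, S) :: s) = true)
    (h_upper : residueCheck k Y P' ((1, S') :: r') Q' s' = true)
    (h_improve : improveCheck Am Ap E Bm Bp F S S' P r Q s P' r' Q' s' = true) :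
    PsiBound Bm Bp F := by
  simp only [improveCheck, Bool.and_eq_true, decide_eq_true_eq, List.all_eq_true,
    List.mem_append] at h_improve
  obtain ⟨⟨⟨⟨⟨⟨h_pos, hS⟩, hS'⟩, h_low⟩, h_low_err⟩, h_up⟩, h_up_err⟩ := h_improve
  intro x hx y hy hyx
  have hℓ : 0 ≤ Real.log x + 1 := by linarith [Real.log_nonneg hx]
  have h_cons : ∀ {c : List (ℕ × ℕ)} {T : ℕ}, (∀ p ∈ c, 0 < p.1) →
      ∀ p ∈ (1, T) :: c, 0 < p.1 := by
    intro c T hc p hp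
    rcases List.mem_cons.1 hp with rfl | hp
    exacts [Nat.one_pos, hc p hp]
  have h_psi : ψ ((⌊y⌋₊ / 1 : ℕ) : ℝ) = ψ y := by rw [Nat.div_one, ← psi_eq_psi_coe_floor]
  constructor
  · have h_le := weightedSum_le_of_residueCheck h_lower (fun p hp => h_pos p (by simp [hp]))
      (h_cons fun p hp => h_pos p (by simp [hp])) ⌊y⌋₊
    rw [weightedSum_cons (1, S)] at h_le
    simp only [h_psi] at h_le
    have h_pr := (slope_bounds h hx hy hyx (L := P) (c := r) (fun p hp => h_pos p (by simp [hp]))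
      (fun p hp => h_pos p (by simp [hp]))).1
    have h_qs := (slope_bounds h hx hy hyx (L := Q) (c := s) (fun p hp => h_pos p (by simp [hp]))
      (fun p hp => h_pos p (by simp [hp]))).2
    have h_slope : (slopeUp Q s Ap + S * Bm : ℝ) * y ≤ slopeLow P r Am * y :=
      mul_le_mul_of_nonneg_right (by exact_mod_cast h_low) hy.le
    have h_err : (slopeError P r E + slopeError Q s E : ℝ) * (Real.log x + 1) ≤
        (S * F : ℝ) * (Real.log x + 1) :=
      mul_le_mul_of_nonneg_right (by exact_mod_cast h_low_err) hℓ
    refine le_of_mul_le_mul_left ?_ (Nat.cast_pos.2 hS : (0 : ℝ) < S)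
    linarith
  · have h_le := weightedSum_le_of_residueCheck h_upper
      (h_cons fun p hp => h_pos p (by simp [hp])) (fun p hp => h_pos p (by simp [hp])) ⌊y⌋₊
    rw [weightedSum_cons (1, S')] at h_le
    simp only [h_psi] at h_le
    have h_pr := (slope_bounds h hx hy hyx (L := P') (c := r') (fun p hp => h_pos p (by simp [hp]))
      (fun p hp => h_pos p (by simp [hp]))).1
    have h_qs := (slope_bounds h hx hy hyx (L := Q') (c := s') (fun p hp => h_pos p (by simp [hp]))
      (fun p hp => h_pos p (by simp [hp]))).2
    have h_slope : (slopeUp Q' s' Ap : ℝ) * y ≤ (slopeLow P' r' Am + S' * Bp : ℝ) * y :=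
      mul_le_mul_of_nonneg_right (by exact_mod_cast h_up) hy.le
    have h_err : (slopeError P' r' E + slopeError Q' s' E : ℝ) * (Real.log x + 1) ≤
        (S' * F : ℝ) * (Real.log x + 1) :=
      mul_le_mul_of_nonneg_right (by exact_mod_cast h_up_err) hℓ
    refine le_of_mul_le_mul_left ?_ (Nat.cast_pos.2 hS' : (0 : ℝ) < S')
    linarith

theorem psiBound_chebyshev : PsiBound 0 5390000000 0 := by
  intro x hx y hy hyx
  have h_nonneg : 0 ≤ ψ y := psi_nonneg y
  have h_le := psi_le_const_mul_self hy.le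
  have h_log4 : Real.log 4 ≤ 1.39 := by
    rw [show (4 : ℝ) = 2 ^ 2 by norm_num, Real.log_pow]
    have := Real.log_two_lt_d9
    push_cast; linarith
  have := mul_le_mul_of_nonneg_right h_log4 hy.le
  push_cast
  constructor <;> linarith

/-- The list `P` of the coarse lower certificate for `ψ`. -/
def coarseLowerResPos : List (ℕ × ℕ) :=
  [(2, 5000000), (3, 3333333), (5, 2000000), (7, 1428571), (11, 904302), (13, 769231),
   (16, 122762), (17, 364498), (18, 195068), (19, 341514), (27, 35577), (28, 196096),
   (30, 293498), (31, 220973), (36, 60619), (40, 15512), (42, 133129), (45, 80960), (46, 14190),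
   (48, 26055), (50, 30800), (53, 33386), (54, 61962), (58, 56), (61, 354), (63, 26691),
   (66, 44235), (70, 6356), (74, 1061), (77, 10851), (78, 28775), (79, 24765), (82, 20554),
   (87, 23719), (89, 14892), (92, 2602), (98, 18210)]

/-- The list `r` of the coarse lower certificate for `ψ`. -/
def coarseLowerStepNeg : List (ℕ × ℕ) :=
  []

/-- The list `Q` of the coarse lower certificate for `ψ`. -/
def coarseLowerResNeg : List (ℕ × ℕ) :=
  [(6, 1666667), (10, 994733), (14, 714286), (15, 544044), (20, 2634), (21, 219835),
   (22, 234827), (23, 7156), (26, 153784), (32, 61381), (33, 85807), (34, 61816), (35, 140995),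
   (37, 2121), (38, 69044), (39, 100584), (41, 40502), (43, 41110), (44, 7457), (47, 8710),
   (49, 22636), (51, 15011), (52, 1136), (55, 39599), (56, 577), (57, 64921), (59, 27970),
   (60, 2051), (62, 92217), (64, 21309), (65, 4614), (67, 8234), (68, 7797), (69, 14113),
   (71, 8330), (72, 39292), (73, 9570), (75, 24524), (76, 14254), (80, 12169), (81, 20670),
   (83, 9238), (84, 76971), (85, 7841), (86, 6021), (88, 12346), (90, 69754), (91, 6748),
   (93, 13374), (94, 989), (95, 4435), (96, 11406), (97, 19612), (99, 21848), (100, 16088)]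

/-- The list `s` of the coarse lower certificate for `ψ`. -/
def coarseLowerStepPos : List (ℕ × ℕ) :=
  [(445, 713884), (497, 206057), (773, 4344713), (1202, 936081), (1343, 5324636),
   (30000, 100683813)]

/-- The list `P` of the coarse upper certificate for `ψ`. -/
def coarseUpperResPos : List (ℕ × ℕ) :=
  [(6, 1666667), (10, 1000000), (14, 591669), (15, 666667), (21, 161284), (22, 454545),
   (25, 140735), (26, 129622), (27, 27833), (28, 34469), (31, 19866), (32, 26482), (33, 103900),
   (34, 93555), (35, 58289), (36, 42303), (37, 2164), (38, 55711), (39, 42299), (44, 14668),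
   (46, 133384), (47, 25505), (49, 98617), (55, 26590), (57, 22240), (58, 63320), (61, 25885),
   (65, 72322), (67, 816), (68, 6444), (69, 34548), (71, 3435), (76, 15958), (80, 1818),
   (82, 5095), (85, 11496), (89, 8808), (90, 55851), (91, 6129), (95, 12270), (96, 34776),
   (99, 22402)]

/-- The list `r` of the coarse upper certificate for `ψ`. -/
def coarseUpperStepNeg : List (ℕ × ℕ) :=
  []

/-- The list `Q` of the coarse upper certificate for `ψ`. -/
def coarseUpperResNeg : List (ℕ × ℕ) :=
  [(2, 5000000), (3, 3333333), (5, 2000000), (7, 1428571), (11, 909091), (13, 637182),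
   (17, 438987), (18, 140957), (19, 172772), (20, 5214), (23, 288534), (24, 82037),
   (29, 178043), (30, 215755), (40, 13682), (41, 10191), (42, 52633), (43, 9831), (45, 98269),
   (48, 62752), (50, 33879), (51, 13852), (52, 29790), (53, 41480), (54, 28493), (56, 100176),
   (59, 29101), (60, 37103), (62, 28661), (63, 6998), (64, 74228), (66, 95882), (70, 71817),
   (72, 9906), (73, 170), (74, 1082), (75, 47765), (77, 22852), (78, 19167), (79, 7177),
   (81, 25859), (83, 10223), (84, 28682), (86, 5275), (87, 24998), (88, 7912), (92, 21493),
   (93, 6622), (94, 4911), (97, 42921), (98, 46926), (100, 17202)]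

/-- The list `s` of the coarse upper certificate for `ψ`. -/
def coarseUpperStepPos : List (ℕ × ℕ) :=
  [(399, 429158), (555, 1482907), (773, 2507760), (1343, 10254713), (30000, 109521642)]

/-- The list `P` of the fine lower certificate for `ψ`. -/
def fineLowerResPos : List (ℕ × ℕ) :=
  [(2, 5000000), (3, 3333333), (5, 2000000), (7, 1428571), (11, 909091), (13, 769231),
   (17, 588235), (19, 526316), (23, 434783), (29, 344828), (30, 333333), (31, 322581),
   (37, 270270), (40, 35530), (41, 209239), (42, 238095), (43, 232558), (47, 212766),
   (53, 188679), (59, 112433), (61, 163934), (66, 231683), (67, 18872), (70, 142857),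
   (71, 140845), (73, 136986), (78, 82673), (79, 126582), (83, 120482), (89, 112360),
   (92, 11907), (97, 33933), (99, 2505), (101, 40803), (102, 100223), (103, 60453),
   (105, 95238), (107, 62696), (108, 455), (109, 91292), (110, 90909), (113, 88496),
   (114, 87062), (126, 11095), (127, 32816), (130, 50427), (136, 38877), (137, 34400),
   (138, 72464), (139, 71942), (147, 6451), (151, 14310), (153, 36995), (154, 20202),
   (155, 3130), (156, 22766), (162, 8385), (165, 71143), (169, 1318), (170, 57513),
   (171, 10291), (172, 10801), (173, 22190), (174, 38554), (176, 16654), (179, 6488),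
   (180, 6452), (181, 48832), (182, 54945), (186, 31586), (190, 8614), (191, 8222),
   (192, 52435), (195, 18213), (197, 50761), (199, 50251), (200, 22692), (211, 11676),
   (212, 8645), (215, 101), (221, 15062), (222, 45045), (225, 2991), (227, 1356), (229, 3607),
   (230, 38513), (231, 34832), (233, 10277), (238, 12806), (239, 23634), (240, 10041),
   (241, 37391), (246, 6510), (248, 27684), (250, 33421)]

/-- The list `r` of the fine lower certificate for `ψ`. -/
def fineLowerStepNeg : List (ℕ × ℕ) :=
  [(334, 21538951), (518, 13811410), (694, 9019887), (930, 1786601), (1553, 21713630),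
   (1671, 1097907), (1934, 405353)]

/-- The list `Q` of the fine lower certificate for `ψ`. -/
def fineLowerResNeg : List (ℕ × ℕ) :=
  [(6, 1666667), (10, 1000000), (14, 714286), (15, 666667), (21, 476190), (22, 454545),
   (26, 384615), (33, 303030), (34, 294118), (35, 285714), (38, 263158), (39, 256410),
   (46, 217391), (51, 196078), (55, 181818), (57, 174125), (58, 115663), (62, 161290),
   (65, 100854), (69, 144928), (74, 135135), (77, 83747), (80, 17765), (82, 104619),
   (85, 117647), (86, 116279), (87, 114943), (91, 109890), (93, 30964), (94, 59029), (95, 788),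
   (96, 34843), (98, 9676), (100, 59596), (106, 63287), (111, 90090), (115, 86957),
   (116, 28375), (118, 56217), (119, 84034), (120, 11843), (122, 81967), (123, 13020),
   (124, 1821), (125, 7595), (128, 2141), (129, 8479), (132, 40084), (133, 75188), (134, 9436),
   (141, 21226), (142, 70423), (144, 36347), (145, 22700), (146, 22545), (149, 45993),
   (150, 9643), (157, 17885), (158, 33886), (159, 20702), (160, 62500), (161, 145),
   (163, 16500), (166, 9409), (167, 1058), (178, 60259), (183, 54645), (184, 5954),
   (185, 42642), (187, 10006), (188, 7633), (189, 11101), (194, 11329), (196, 5867),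
   (198, 27975), (201, 6291), (202, 20401), (203, 28214), (204, 22036), (205, 41848),
   (206, 13658), (207, 1253), (208, 15162), (209, 15138), (210, 44285), (213, 6409),
   (214, 16678), (216, 6516), (217, 4905), (218, 45646), (219, 20325), (220, 7902),
   (223, 16545), (224, 18011), (226, 44248), (228, 13978), (235, 11722), (236, 648),
   (237, 32151), (247, 39698), (249, 33888)]

/-- The list `s` of the fine lower certificate for `ψ`. -/
def fineLowerStepPos : List (ℕ × ℕ) :=
  [(103, 3550615), (173, 2468659), (268, 18904537), (448, 27063162), (600, 8707860),
   (804, 1764720), (865, 12326087), (1247, 25990635), (2239, 7679277), (2788, 20591520),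
   (100000, 513258025)]

/-- The list `P` of the fine upper certificate for `ψ`. -/
def fineUpperResPos : List (ℕ × ℕ) :=
  [(6, 1666667), (10, 1000000), (14, 714286), (15, 666667), (21, 476190), (22, 454545),
   (26, 384615), (33, 303030), (34, 294118), (35, 285714), (38, 263158), (39, 256410),
   (46, 217391), (49, 11887), (50, 11744), (51, 173144), (55, 181818), (57, 175439),
   (58, 172414), (62, 64597), (64, 25012), (65, 153846), (69, 144928), (74, 118612),
   (77, 129870), (82, 121951), (85, 61360), (86, 97988), (87, 114943), (88, 17875),
   (91, 109890), (93, 90314), (94, 106383), (95, 105263), (96, 16675), (106, 94340),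
   (109, 22859), (111, 31490), (112, 5550), (115, 22518), (118, 43328), (119, 84034),
   (120, 7125), (122, 45949), (123, 81301), (124, 35437), (129, 19170), (132, 5036),
   (133, 38040), (134, 74627), (140, 24480), (142, 85777), (143, 8967), (145, 68966),
   (146, 22883), (148, 8261), (150, 32328), (155, 9562), (158, 1674), (159, 50728),
   (160, 54038), (161, 43500), (162, 8259), (168, 13208), (176, 4690), (177, 47003),
   (178, 32083), (180, 38404), (184, 15953), (185, 27418), (187, 6255), (194, 14398),
   (196, 34668), (198, 4587), (201, 39878), (202, 33592), (203, 11725), (204, 3191),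
   (205, 6987), (206, 27919), (208, 20339), (210, 40372), (213, 11472), (214, 36241),
   (217, 38706), (219, 15255), (221, 45249), (225, 24162), (226, 28813), (234, 32242),
   (236, 17086), (237, 19465), (240, 6562), (241, 9572), (249, 9539), (250, 9013)]

/-- The list `r` of the fine upper certificate for `ψ`. -/
def fineUpperStepNeg : List (ℕ × ℕ) :=
  [(103, 1904345), (268, 13229), (359, 17084564), (448, 11993994), (600, 11985137),
   (1443, 7175584), (1553, 3355092), (2081, 2265634)]

/-- The list `Q` of the fine upper certificate for `ψ`. -/
def fineUpperResNeg : List (ℕ × ℕ) :=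
  [(2, 5000000), (3, 3333333), (5, 2000000), (7, 1428571), (11, 909091), (13, 769231),
   (17, 588235), (19, 526316), (23, 434783), (29, 344828), (30, 333333), (31, 270943),
   (32, 50024), (37, 270270), (41, 243902), (42, 238095), (43, 195976), (44, 35751),
   (47, 212766), (53, 188679), (59, 155000), (60, 14250), (61, 91898), (66, 151515),
   (67, 149254), (70, 142857), (71, 140845), (73, 45766), (75, 72485), (78, 128205),
   (79, 58396), (80, 50611), (81, 16517), (83, 28616), (84, 33816), (89, 64167), (90, 47657),
   (97, 103093), (98, 5944), (100, 5872), (101, 99010), (102, 86572), (103, 53067),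
   (104, 25286), (105, 95238), (107, 72483), (108, 6232), (110, 21592), (113, 57626),
   (114, 78982), (116, 27790), (117, 48058), (128, 31609), (130, 76923), (131, 18877),
   (135, 12430), (137, 72993), (138, 49926), (147, 3962), (149, 67114), (151, 58479),
   (154, 20019), (157, 23674), (163, 25708), (164, 35424), (165, 46211), (167, 54825),
   (169, 1317), (170, 483), (171, 5825), (172, 3386), (173, 14969), (174, 96416), (175, 23938),
   (181, 46405), (182, 24152), (183, 3838), (186, 29990), (188, 1436), (190, 52632),
   (191, 47665), (192, 13004), (193, 14473), (195, 31456), (197, 2349), (207, 3551),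
   (211, 11325), (212, 255), (215, 5964), (216, 8023), (218, 11429), (220, 27508), (222, 10238),
   (223, 23048), (224, 17327), (227, 31556), (228, 16810), (229, 22497), (230, 30515),
   (231, 31150), (233, 5271), (235, 2952), (238, 42017), (239, 31489), (242, 18381),
   (243, 10319), (245, 5447), (246, 2049), (247, 11162)]

/-- The list `s` of the fine upper certificate for `ψ`. -/
def fineUpperStepPos : List (ℕ × ℕ) :=
  [(215, 12115175), (334, 18035495), (518, 25747623), (694, 12260586), (1159, 6115099),
   (1247, 4904391), (1798, 9287021), (2409, 14942788), (2788, 9750070), (100000, 517711325)]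

theorem psiBound_coarse : PsiBound 945500000 1053800000 32 :=
  psiBound_chebyshev.improve (k := 32) (Y := 30000) (S := 10000230) (S' := 9999937)
    (P := coarseLowerResPos) (r := coarseLowerStepNeg) (Q := coarseLowerResNeg)
    (s := coarseLowerStepPos) (P' := coarseUpperResPos) (r' := coarseUpperStepNeg)
    (Q' := coarseUpperResNeg) (s' := coarseUpperStepPos)
    (by decide +kernel) (by decide +kernel) (by decide +kernel)

theorem psiBound_fine : PsiBound 982900000 1016500000 2400 :=
  psiBound_coarse.improve (k := 32) (Y := 100000) (S := 9999994) (S' := 9999542)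
    (P := fineLowerResPos) (r := fineLowerStepNeg) (Q := fineLowerResNeg)
    (s := fineLowerStepPos) (P' := fineUpperResPos) (r' := fineUpperStepNeg)
    (Q' := fineUpperResNeg) (s' := fineUpperStepPos)
    (by decide +kernel) (by decide +kernel) (by decide +kernel)

theorem sqrt_term_bound {x X : ℝ} (hx : 4 * 10 ^ 7 ≤ x) (hX : X = 1.0402 * x) :
    1.0165 * x + 4800 * (Real.log X + 1) + 16.17 * √X < 0.9829 * X := by
  have hX0 : 0 < X := by rw [hX]; linarith
  have h_exp : (65000000 : ℝ) ≤ Real.exp 18 := by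
    have h := pow_le_pow_left₀ (by norm_num) Real.exp_one_gt_d9.le 18
    rw [← Real.exp_nat_mul] at h
    norm_num at h ⊢
    linarith
  have h_log : Real.log X ≤ 17 + X / 65000000 := by
    have h := Real.log_le_sub_one_of_pos (div_pos hX0 (Real.exp_pos 18))
    rw [Real.log_div hX0.ne' (Real.exp_pos 18).ne', Real.log_exp] at h
    have h_div : X / Real.exp 18 ≤ X / 65000000 :=
      div_le_div_of_nonneg_left hX0.le (by norm_num) h_exp
    linarith
  have h_sqrt : √X ≤ (X + 6450 ^ 2) / 12900 := by
    have h := Real.sq_sqrt hX0.le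
    rw [le_div_iff₀ (by norm_num)]
    nlinarith [sq_nonneg (√X - 6450)]
  rw [hX] at h_log h_sqrt ⊢
  norm_num at h_log h_sqrt ⊢
  linarith

theorem psi_sub_theta_le_mul_sqrt {x : ℝ} (hx : 1 ≤ x) : ψ x - θ x ≤ 16.17 * √x := by
  have h_root : ∀ e : ℝ, 2 ≤ e → ψ (x ^ e⁻¹) ≤ 5.39 * √x := by
    intro e he
    have h_pow : x ^ e⁻¹ ≤ √x := by
      rw [Real.sqrt_eq_rpow]
      refine Real.rpow_le_rpow_of_exponent_le hx ?_
      rw [one_div]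
      exact inv_anti₀ (by norm_num) he
    have h_pos : 0 < x ^ e⁻¹ := Real.rpow_pos_of_pos (by linarith) _
    have h := (psiBound_chebyshev (max 1 (x ^ e⁻¹)) (le_max_left _ _) _ h_pos
      (le_max_right _ _)).2
    norm_num at h ⊢
    linarith
  have h := psi_sub_theta_le_psi_add_psi_add_psi x
  linarith [h_root 2 (by norm_num), h_root 3 (by norm_num), h_root 5 (by norm_num)]

theorem exists_prime_of_theta_lt {x y : ℝ} (h : θ x < θ y) :
    ∃ p : ℕ, p.Prime ∧ x < p ∧ p ≤ y := by
  by_contra! h_none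
  refine h.not_ge ?_
  rw [theta, theta]
  refine Finset.sum_le_sum_of_subset_of_nonneg (fun p hp => ?_) fun p _ _ =>
    Real.log_natCast_nonneg p
  simp only [Finset.mem_filter, Finset.mem_Ioc] at hp ⊢
  obtain ⟨⟨hp0, hpy⟩, hp⟩ := hp
  refine ⟨⟨hp0, ?_⟩, hp⟩
  by_contra h_gt
  have hy : 0 ≤ y := by
    by_contra hy
    rw [Nat.floor_of_nonpos (by linarith)] at hpy
    omega
  exact absurd ((Nat.le_floor_iff hy).1 hpy)
    (not_le.2 (h_none p hp (Nat.lt_of_floor_lt (not_le.1 h_gt))))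

theorem exists_prime_of_large {x : ℝ} (hx : 4 * 10 ^ 7 ≤ x) :
    ∃ p : ℕ, p.Prime ∧ x < p ∧ p ≤ 1.0402 * x := by
  refine exists_prime_of_theta_lt ?_
  obtain ⟨X, hX⟩ : ∃ X, X = 1.0402 * x := ⟨_, rfl⟩
  have hX1 : 1 ≤ X := by rw [hX]; linarith
  have hX0 : 0 < X := by linarith
  have hxX : x ≤ X := by rw [hX]; linarith
  have h_bound := sqrt_term_bound hx hX
  have h_lower := (psiBound_fine X hX1 X hX0 le_rfl).1
  have h_upper := (psiBound_fine X hX1 x (by linarith) hxX).2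
  have h_theta := theta_le_psi x
  have h_sub := psi_sub_theta_le_mul_sqrt hX1
  rw [← hX]
  norm_num at h_lower h_upper h_bound h_sub
  linarith

/-- The product of the numbers `a + 1, …, a + 2 ^ k`. -/
def rangeProd : ℕ → ℕ → ℕ
  | 0, a => a + 1
  | k + 1, a => rangeProd k a * rangeProd k (a + 2 ^ k)

theorem dvd_rangeProd {k a d : ℕ} (h_lt : a < d) (h_le : d ≤ a + 2 ^ k) : d ∣ rangeProd k a := by
  induction k generalizing a with
  | zero => exact (show d = a + 1 by rw [pow_zero] at h_le; omega).dvd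
  | succ k ih =>
    rcases le_or_gt d (a + 2 ^ k) with h | h
    · exact (ih h_lt h).mul_right _
    · exact (ih h (by rw [pow_succ] at h_le; omega)).mul_left _

/-- Decides primality of `p` by a coprimality test with a product of consecutive numbers. -/
def primeCheck (p : ℕ) : Bool :=
  let k := if p < 81 then 3 else if p < 4225 then 6 else if p < 16641 then 7 else 13
  decide (1 < p) && decide (p < (2 ^ k + 1) ^ 2) && decide (Nat.gcd p (rangeProd k 0) = 1)

theorem prime_of_primeCheck {p : ℕ} (h : primeCheck p = true) : p.Prime := by
  simp only [primeCheck, Bool.and_eq_true, decide_eq_true_eq] at h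
  generalize (if p < 81 then 3 else if p < 4225 then 6 else if p < 16641 then 7 else 13) = k at h
  obtain ⟨⟨h_one, h_lt⟩, h_gcd⟩ := h
  by_contra h_not
  have h_sq := Nat.minFac_sq_le_self (by omega) h_not
  have h_prime := Nat.minFac_prime (n := p) (by omega)
  have h_le : p.minFac ≤ 0 + 2 ^ k := by
    have := lt_of_pow_lt_pow_left₀ 2 (Nat.zero_le _) (h_sq.trans_lt h_lt)
    omega
  exact h_prime.one_lt.ne' (Nat.dvd_one.1 (h_gcd ▸ Nat.dvd_gcd p.minFac_dvd
    (dvd_rangeProd h_prime.pos h_le)))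

/-- Decides that a list of primes has small gaps. -/
def gapCheck : ℕ → List ℕ → Bool
  | _, [] => true
  | a, p :: l => (decide (p ≤ a + 28) || decide (10000 * p ≤ 10402 * (a + 1))) &&
    primeCheck p && gapCheck p l

theorem exists_prime_of_gapCheck {a b : ℕ} {l : List ℕ} (h : gapCheck a l = true) (ha : a < b)
    (hb : ∃ p ∈ l, b ≤ p) :
    ∃ p, p.Prime ∧ b ≤ p ∧ (p ≤ b + 27 ∨ 10000 * p ≤ 10402 * b) := by
  induction l generalizing a with
  | nil => simp at hb
  | cons p l ih =>
    simp only [gapCheck, Bool.and_eq_true, Bool.or_eq_true, decide_eq_true_eq] at h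
    obtain ⟨⟨h_gap, hp⟩, hl⟩ := h
    by_cases hbp : b ≤ p
    · exact ⟨p, prime_of_primeCheck hp, hbp, by omega⟩
    · refine ih hl (by omega) ?_
      obtain ⟨r, hr, hbr⟩ := hb
      rcases List.mem_cons.1 hr with rfl | hr
      exacts [absurd hbr hbp, ⟨r, hr, hbr⟩]

/-- Primes up to `4 * 10 ^ 7` with small gaps. -/
def primeChain : List ℕ :=
  [23, 47, 73, 101, 127, 151, 179, 199, 227, 251, 277, 293, 317, 337, 359, 383, 409, 433, 461,
   487, 509, 523, 547, 571, 599, 619, 647, 673, 701, 727, 757, 787, 811, 839, 863, 887, 919, 953,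
   991, 1031, 1069, 1109, 1153, 1193, 1237, 1283, 1327, 1381, 1433, 1489, 1549, 1609, 1669, 1733,
   1801, 1873, 1949, 2027, 2099, 2179, 2267, 2357, 2447, 2543, 2633, 2731, 2837, 2939, 3049, 3169,
   3271, 3391, 3527, 3659, 3803, 3947, 4099, 4261, 4423, 4597, 4759, 4951, 5147, 5351, 5563, 5783,
   6011, 6247, 6491, 6737, 7001, 7283, 7573, 7877, 8191, 8521, 8863, 9209, 9551, 9931, 10331,
   10739, 11171, 11621, 12073, 12553, 13049, 13567, 14107, 14669, 15259, 15859, 16493, 17137,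
   17807, 18523, 19267, 20029, 20809, 21617, 22483, 23371, 24281, 25253, 26267, 27299, 28393,
   29531, 30713, 31907, 33181, 34513, 35899, 37339, 38839, 40387, 41999, 43669, 45413, 47237,
   49123, 51071, 53117, 55249, 57467, 59771, 62171, 64667, 67261, 69959, 72767, 75689, 78721,
   81883, 85159, 88547, 92107, 95803, 99643, 103643, 107791, 112121, 116593, 121271, 126143,
   131213, 136483, 141961, 147661, 153589, 159763, 166183, 172859, 179807, 187027, 194543, 202361,
   210491, 218947, 227743, 236897, 246403, 256307, 266603, 277309, 288433, 300023, 312083, 324619,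
   337669, 351229, 365333, 379999, 395273, 411157, 427681, 444869, 462739, 481307, 500629, 520747,
   541669, 563419, 586067, 609619, 634103, 659591, 686099, 713681, 742369, 772207, 803237, 835511,
   869081, 904019, 940361, 978157, 1017479, 1058381, 1100921, 1145173, 1191209, 1239089, 1288891,
   1340701, 1394579, 1450639, 1508953, 1569611, 1632703, 1698313, 1766581, 1837573, 1911439,
   1988279, 2068201, 2151337, 2237813, 2327771, 2421347, 2518667, 2619917, 2725237, 2834789,
   2948747, 3067279, 3190571, 3318817, 3452227, 3590971, 3735323, 3885461, 4041619, 4204091,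
   4373087, 4548883, 4731733, 4921949, 5119811, 5325623, 5539673, 5762359, 5993993, 6234923,
   6485543, 6746261, 7017431, 7299529, 7592969, 7898203, 8215699, 8545967, 8889499, 9246847,
   9618563, 10005227, 10407437, 10825817, 11261011, 11713703, 12184589, 12674383, 13183889,
   13713859, 14265151, 14838587, 15435097, 16055573, 16701001, 17372371, 18070733, 18797171,
   19552807, 20338807, 21156419, 22006879, 22891543, 23811763, 24768979, 25764679, 26800409,
   27877783, 28998467, 30164161, 31376759, 32638097, 33950143, 35314897, 36734531, 38211253,
   39747329, 41345167]

theorem gapCheck_primeChain :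
    gapCheck 0 primeChain = true ∧ ∃ p ∈ primeChain, 4 * 10 ^ 7 ≤ p := by
  decide +kernel

/-- Every interval `[b, max (b + 27) (1.0402 * b)]` with `b` positive contains a prime. -/
theorem exists_prime_near {b : ℕ} (hb : 0 < b) :
    ∃ p, p.Prime ∧ b ≤ p ∧ (p ≤ b + 27 ∨ 10000 * p ≤ 10402 * b) := by
  rcases le_total b (4 * 10 ^ 7) with h | h
  · obtain ⟨h_gap, p, hp, h_le⟩ := gapCheck_primeChain
    exact exists_prime_of_gapCheck h_gap hb ⟨p, hp, h.trans h_le⟩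
  · obtain ⟨p, hp, h_lt, h_le⟩ := exists_prime_of_large (x := b) (by exact_mod_cast h)
    refine ⟨p, hp, by exact_mod_cast h_lt.le, Or.inr ?_⟩
    have : (10000 * p : ℝ) ≤ 10402 * b := by norm_num at h_le; linarith
    exact_mod_cast this

end PrimeGaps

/-- The sum of the prime powers exactly dividing `m`. -/
def primePowerSum (m : ℕ) : ℕ := ∑ p ∈ m.primeFactors, p ^ m.factorization p

theorem primePowerSum_one : primePowerSum 1 = 0 := by simp [primePowerSum]

theorem primePowerSum_prime_pow {p k : ℕ} (hp : p.Prime) (hk : k ≠ 0) :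
    primePowerSum (p ^ k) = p ^ k := by
  simp [primePowerSum, Nat.primeFactors_prime_pow hk hp, hp.factorization]

theorem primePowerSum_mul {a b : ℕ} (h : a.Coprime b) :
    primePowerSum (a * b) = primePowerSum a + primePowerSum b := by
  rw [primePowerSum, h.primeFactors_mul, Finset.sum_union h.disjoint_primeFactors]
  congr 1
  · exact Finset.sum_congr rfl fun p hp => by
      rw [Nat.factorization_eq_of_coprime_left h
        (Nat.mem_primeFactors_iff_mem_primeFactorsList.1 hp)]
  · exact Finset.sum_congr rfl fun p hp => by
      rw [Nat.factorization_eq_of_coprime_right h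
        (Nat.mem_primeFactors_iff_mem_primeFactorsList.1 hp)]

theorem primePowerSum_prime_pow_mul {p k m : ℕ} (hp : p.Prime) (hk : k ≠ 0) (hm : ¬ p ∣ m) :
    primePowerSum (p ^ k * m) = p ^ k + primePowerSum m := by
  rw [primePowerSum_mul (((Nat.Prime.coprime_iff_not_dvd hp).2 hm).pow_left k),
    primePowerSum_prime_pow hp hk]

theorem primePowerSum_add_le {p m : ℕ} (hp : p.Prime) (hm : m ≠ 0) :
    primePowerSum m + p ≤ primePowerSum (p * m) := by
  obtain ⟨k, c, hc, rfl⟩ := Nat.exists_eq_pow_mul_and_not_dvd hm p hp.ne_one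
  rw [← mul_assoc, ← pow_succ', primePowerSum_prime_pow_mul hp (Nat.succ_ne_zero k) hc]
  rcases Nat.eq_zero_or_pos k with rfl | hk
  · simp [add_comm]
  · rw [primePowerSum_prime_pow_mul hp hk.ne' hc]
    have h_le : p ≤ p ^ k := Nat.le_self_pow hk.ne' p
    have h_two := Nat.mul_le_mul_right (p ^ k) hp.two_le
    rw [pow_succ']
    omega

theorem primePowerSum_le {m : ℕ} (hm : m ≠ 0) : primePowerSum m ≤ m := by
  induction m using Nat.recOnPosPrimePosCoprime with
  | prime_pow p k hp hk => rw [primePowerSum_prime_pow hp hk.ne']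
  | zero => exact absurd rfl hm
  | one => simp [primePowerSum_one]
  | coprime a b ha hb hab iha ihb =>
    rw [primePowerSum_mul hab]
    nlinarith [iha (by omega), ihb (by omega)]

theorem primePowerSum_lcm_le {a b : ℕ} (ha : a ≠ 0) (hb : b ≠ 0) :
    primePowerSum (a.lcm b) ≤ primePowerSum a + primePowerSum b := by
  have h_fact : ∀ p, (a.lcm b).factorization p = max (a.factorization p) (b.factorization p) := by
    intro p
    rw [Nat.factorization_lcm ha hb]
    rfl
  have h_union : (a.lcm b).primeFactors = a.primeFactors ∪ b.primeFactors := by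
    ext p
    simp only [← Nat.support_factorization, Finsupp.mem_support_iff, Finset.mem_union, h_fact]
    omega
  have h_ite : ∀ (c : ℕ), c.primeFactors ⊆ a.primeFactors ∪ b.primeFactors → primePowerSum c =
      ∑ p ∈ a.primeFactors ∪ b.primeFactors,
        if p ∈ c.primeFactors then p ^ c.factorization p else 0 := by
    intro c hc
    rw [Finset.sum_ite_mem, Finset.inter_eq_right.2 hc, primePowerSum]
  rw [h_ite a Finset.subset_union_left, h_ite b Finset.subset_union_right,
    ← Finset.sum_add_distrib, primePowerSum, h_union]
  refine Finset.sum_le_sum fun p hp => ?_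
  rw [h_fact]
  simp only [← Nat.support_factorization, Finsupp.mem_support_iff, Finset.mem_union] at hp ⊢
  rcases le_total (a.factorization p) (b.factorization p) with h | h
  · rw [max_eq_right h, if_pos (by omega : b.factorization p ≠ 0)]
    exact Nat.le_add_left _ _
  · rw [max_eq_left h, if_pos (by omega : a.factorization p ≠ 0)]
    exact Nat.le_add_right _ _

theorem primePowerSum_multiset_lcm_le {s : Multiset ℕ} (hs : ∀ a ∈ s, a ≠ 0) :
    primePowerSum s.lcm ≤ s.sum := by
  induction s using Multiset.induction with
  | empty => simp [primePowerSum_one]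
  | cons a s ih =>
    have ha := hs a (Multiset.mem_cons_self a s)
    have h_tail := fun b hb => hs b (Multiset.mem_cons_of_mem (a := b) (b := a) hb)
    rw [Multiset.lcm_cons, Multiset.sum_cons]
    refine (primePowerSum_lcm_le ha ?_).trans (Nat.add_le_add (primePowerSum_le ha) (ih h_tail))
    rw [Ne, Multiset.lcm_eq_zero_iff]
    exact fun h => h_tail 0 h rfl

theorem primePowerSum_orderOf_le {n : ℕ} (σ : Equiv.Perm (Fin n)) :
    primePowerSum (orderOf σ) ≤ n := by
  rw [← Equiv.Perm.lcm_cycleType]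
  refine (primePowerSum_multiset_lcm_le fun a ha => ?_).trans ?_
  · have := Equiv.Perm.two_le_of_mem_cycleType ha
    omega
  · simpa using σ.sum_cycleType_le

theorem le_g {m n : ℕ} (hm : m ≠ 0) (h : primePowerSum m ≤ n) : m ≤ g n := by
  obtain ⟨σ, hσ⟩ := (Equiv.Perm.exists_with_cycleType_iff (α := Fin n)
    (m := m.primeFactors.val.map fun p => p ^ m.factorization p)).2 ⟨by
      rw [Fintype.card_fin]; exact h, by
      intro a ha
      obtain ⟨p, hp, rfl⟩ := Multiset.mem_map.1 ha
      have hp' := Nat.mem_primeFactors.1 (Finset.mem_def.2 hp)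
      exact hp'.1.two_le.trans
        (Nat.le_self_pow (hp'.1.factorization_pos_of_dvd hm hp'.2.1).ne' p)⟩
  have h_dvd : m ∣ orderOf σ := by
    rw [Nat.dvd_iff_prime_pow_dvd_dvd]
    intro p k hp hpk
    rcases Nat.eq_zero_or_pos k with rfl | hk
    · simp
    refine (pow_dvd_pow p ((hp.pow_dvd_iff_le_factorization hm).1 hpk)).trans ?_
    rw [← Equiv.Perm.lcm_cycleType, hσ]
    exact Multiset.dvd_lcm (Multiset.mem_map_of_mem _ (Finset.mem_def.1
      (Nat.mem_primeFactors.2 ⟨hp, (dvd_pow_self p hk.ne').trans hpk, hm⟩)))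
  exact (Nat.le_of_dvd (orderOf_pos σ) h_dvd).trans
    (Finset.le_sup (f := fun σ : Equiv.Perm (Fin n) => orderOf σ) (Finset.mem_univ σ))

theorem g_ne_zero (n : ℕ) : g n ≠ 0 := by
  obtain ⟨σ, h⟩ := exists_orderOf_eq_g n
  exact h ▸ (orderOf_pos σ).ne'

theorem primePowerSum_g_le (n : ℕ) : primePowerSum (g n) ≤ n := by
  obtain ⟨σ, h⟩ := exists_orderOf_eq_g n
  exact h ▸ primePowerSum_orderOf_le σ

theorem le_g_of_primePowerSum_le {m n : ℕ} (hm : m ≠ 0)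
    (h : primePowerSum m ≤ primePowerSum (g n)) : m ≤ g n :=
  le_g hm (h.trans (primePowerSum_g_le n))

theorem mul_le_of_add_le {n q p p' a b : ℕ} (hq : q.Prime) (hqg : q ∣ g n) (hp : p.Prime)
    (hp' : p'.Prime) (h_ne : p ≠ p') (hpg : ¬ p ∣ g n) (hpg' : ¬ p' ∣ g n) (ha : a ≠ 0)
    (hb : b ≠ 0) (h : p ^ a + p' ^ b ≤ q) : p ^ a * p' ^ b ≤ q := by
  obtain ⟨m, hm⟩ := hqg
  have hm0 : m ≠ 0 := by rintro rfl; exact g_ne_zero n hm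
  have hpm : ¬ p ∣ m := fun hd => hpg (hm ▸ hd.mul_left q)
  have hpm' : ¬ p' ∣ m := fun hd => hpg' (hm ▸ hd.mul_left q)
  have hp_mul : ¬ p ∣ p' ^ b * m := by
    rw [hp.dvd_mul]
    rintro (hd | hd)
    exacts [h_ne ((Nat.prime_dvd_prime_iff_eq hp hp').1 (hp.dvd_of_dvd_pow hd)), hpm hd]
  have h_sum := primePowerSum_add_le hq hm0
  have h_le := le_g_of_primePowerSum_le (n := n) (m := p ^ a * (p' ^ b * m))
    (mul_ne_zero (pow_ne_zero _ hp.ne_zero) (mul_ne_zero (pow_ne_zero _ hp'.ne_zero) hm0)) (by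
      rw [primePowerSum_prime_pow_mul hp ha hp_mul, primePowerSum_prime_pow_mul hp' hb hpm', hm]
      omega)
  rw [hm, ← mul_assoc] at h_le
  exact Nat.le_of_mul_le_mul_right h_le (Nat.pos_of_ne_zero hm0)

theorem mul_le_mul_of_add_le_add {n q s p p' : ℕ} (hq : q.Prime) (hs : s.Prime) (hqs : q ≠ s)
    (hqg : q ∣ g n) (hsg : s ∣ g n) (hp : p.Prime) (hp' : p'.Prime) (h_ne : p ≠ p')
    (hpg : ¬ p ∣ g n) (hpg' : ¬ p' ∣ g n) (h : p + p' ≤ s + q) : p * p' ≤ s * q := by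
  obtain ⟨m, hm⟩ := ((Nat.coprime_primes hs hq).2 hqs.symm).mul_dvd_of_dvd_of_dvd hsg hqg
  have hm0 : m ≠ 0 := by rintro rfl; exact g_ne_zero n hm
  have hpm : ¬ p ∣ m := fun hd => hpg (hm ▸ hd.mul_left _)
  have hpm' : ¬ p' ∣ m := fun hd => hpg' (hm ▸ hd.mul_left _)
  have hp_mul : ¬ p ∣ p' ^ 1 * m := by
    rw [pow_one, hp.dvd_mul]
    rintro (hd | hd)
    exacts [h_ne ((Nat.prime_dvd_prime_iff_eq hp hp').1 hd), hpm hd]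
  have h_sum := primePowerSum_add_le hq hm0
  have h_sum' := primePowerSum_add_le hs (mul_ne_zero hq.ne_zero hm0)
  have h_le := le_g_of_primePowerSum_le (n := n) (m := p ^ 1 * (p' ^ 1 * m))
    (mul_ne_zero (pow_ne_zero _ hp.ne_zero) (mul_ne_zero (pow_ne_zero _ hp'.ne_zero) hm0)) (by
      rw [primePowerSum_prime_pow_mul hp one_ne_zero hp_mul,
        primePowerSum_prime_pow_mul hp' one_ne_zero hpm', hm, mul_assoc,
        pow_one, pow_one]
      omega)
  rw [hm, ← mul_assoc, pow_one, pow_one] at h_le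
  exact Nat.le_of_mul_le_mul_right h_le (Nat.pos_of_ne_zero hm0)

theorem exists_maximal_pow {p c q : ℕ} (hp : p.Prime) (h : p + c ≤ q) :
    ∃ a, a ≠ 0 ∧ p ^ a + c ≤ q ∧ q < p ^ (a + 1) + c := by
  have h_ex : ∃ a, q < p ^ (a + 1) + c :=
    ⟨q, ((Nat.lt_pow_self hp.one_lt).trans_le
      (Nat.pow_le_pow_right hp.pos (Nat.le_succ q))).trans_le (Nat.le_add_right _ _)⟩
  have h_find := Nat.find_spec h_ex
  have h_zero : Nat.find h_ex ≠ 0 := fun h0 => by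
    rw [h0, zero_add, pow_one] at h_find
    omega
  obtain ⟨k, hk⟩ := Nat.exists_eq_succ_of_ne_zero h_zero
  refine ⟨Nat.find h_ex, h_zero, ?_, h_find⟩
  have h_min := Nat.find_min h_ex (m := k) (by omega)
  rw [hk]
  exact not_lt.1 h_min

theorem lt_add_of_not_dvd {n q p p' : ℕ} (hq : q.Prime) (hqg : q ∣ g n) (hp : p.Prime)
    (hp' : p'.Prime) (h_lt : p < p') (hpg : ¬ p ∣ g n) (hpg' : ¬ p' ∣ g n) : q < p + p' := by
  by_contra! h_le
  obtain ⟨a, ha, ha_le, ha_lt⟩ := exists_maximal_pow hp h_le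
  obtain ⟨b, hb, hb_le, hb_lt⟩ := exists_maximal_pow (c := p ^ a) (q := q) hp' (by omega)
  have h_mul := mul_le_of_add_le hq hqg hp hp' h_lt.ne hpg hpg' ha hb (by omega)
  have hY : p' ≤ p' ^ b := Nat.le_self_pow hb p'
  have hX : p ≤ p ^ a := Nat.le_self_pow ha p
  have hXp : p ^ a = p ∨ p * p ≤ p ^ a := by
    rcases Nat.lt_or_ge 1 a with h1 | h1
    · exact Or.inr (by rw [← sq]; exact Nat.pow_le_pow_right hp.pos h1)
    · exact Or.inl (by rw [show a = 1 by omega, pow_one])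
  have hq_even : q ≠ p * (p + 1) := by
    rintro rfl
    rcases Nat.prime_mul_iff.1 hq with h | h
    · have := hp.one_lt
      omega
    · have := hp.one_lt
      omega
  rw [pow_succ'] at ha_lt hb_lt
  have h_two := hp.two_le
  generalize p ^ a = X at *
  generalize p' ^ b = Y at *
  have hY_gt : p + 1 ≤ Y := by omega
  rcases le_or_gt Y X with hYX | hXY
  · nlinarith
  have hX_pos : 0 < X := by omega
  have h_lt_X : X * Y < p * X + Y := by nlinarith
  rcases hXp with rfl | hX2
  · rcases eq_or_lt_of_le hY_gt with rfl | hY2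
    · have : p' = X + 1 := by omega
      subst this
      exact hq_even (by nlinarith)
    · nlinarith
  · obtain ⟨z, rfl⟩ := Nat.exists_eq_add_of_le hY_gt
    nlinarith

theorem le_largest_prime_of_lt {n q : ℕ} (hn : 500000 < n)
    (hqmax : ∀ r : ℕ, r.Prime → r ∣ g n → r ≤ q) :
    1009 ≤ q := by
  by_contra! hq
  have h_prime : Nat.Prime 1009 := by norm_num
  have h_not : ¬ 1009 ∣ g n := fun h => absurd (hqmax 1009 h_prime h) (by omega)
  have h_pow : ∀ p ∈ (g n).primeFactors, p ^ (g n).factorization p ≤ 2018 := by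
    intro p hp
    obtain ⟨hp, hpg, -⟩ := Nat.mem_primeFactors.1 hp
    have hp_lt := (hqmax p hp hpg).trans_lt hq
    by_contra! h_gt
    have h_dvd := Nat.ordProj_mul_ordCompl_eq_self (g n) p
    have h_compl := Nat.not_dvd_ordCompl hp (g_ne_zero n)
    generalize (g n).factorization p = k at *
    generalize g n / p ^ k = c at *
    obtain ⟨j, rfl⟩ : ∃ j, k = j + 2 := by
      refine ⟨k - 2, ?_⟩
      rcases k with _ | _ | k
      · simp at h_gt
      · simp at h_gt; omega
      · omega
    have hc0 : c ≠ 0 := by rintro rfl; simp at h_compl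
    have hc_not : ¬ 1009 ∣ c := fun h => h_not (h_dvd ▸ h.mul_left _)
    have h_mul_not : ¬ p ∣ 1009 ^ 1 * c := by
      rw [pow_one, hp.dvd_mul]
      rintro (h | h)
      · have := (Nat.prime_dvd_prime_iff_eq hp h_prime).1 h
        omega
      · exact h_compl h
    have h_two : 2 * p ^ (j + 1) ≤ p ^ (j + 2) := by
      rw [pow_succ' p (j + 1)]
      exact Nat.mul_le_mul_right _ hp.two_le
    have h_le := le_g_of_primePowerSum_le (n := n) (m := p ^ (j + 1) * (1009 ^ 1 * c))
      (mul_ne_zero (pow_ne_zero _ hp.ne_zero) (mul_ne_zero (by norm_num) hc0)) (by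
        rw [primePowerSum_prime_pow_mul hp (by omega) h_mul_not,
          primePowerSum_prime_pow_mul h_prime one_ne_zero hc_not, ← h_dvd,
          primePowerSum_prime_pow_mul hp (by omega) h_compl]
        omega)
    rw [← h_dvd, pow_succ p (j + 1), mul_assoc, pow_one] at h_le
    have h_cancel := Nat.le_of_mul_le_mul_right
      (Nat.le_of_mul_le_mul_left h_le (pow_pos hp.pos _)) (Nat.pos_of_ne_zero hc0)
    omega
  have h_card : (g n).primeFactors.card ≤ 240 := by
    have h_sub : (g n).primeFactors ⊆
        (Finset.range 1009).filter fun p => Nat.gcd p 210 = 1 ∨ p ∈ [2, 3, 5, 7] := by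
      intro p hp
      obtain ⟨hp, hpg, -⟩ := Nat.mem_primeFactors.1 hp
      refine Finset.mem_filter.2 ⟨Finset.mem_range.2 ((hqmax p hp hpg).trans_lt hq), ?_⟩
      rcases Nat.coprime_or_dvd_of_prime hp 210 with h | h
      · exact Or.inl h
      · rw [show (210 : ℕ) = 2 * 3 * 5 * 7 by norm_num] at h
        simp only [hp.dvd_mul, Nat.prime_dvd_prime_iff_eq hp Nat.prime_two,
          Nat.prime_dvd_prime_iff_eq hp Nat.prime_three,
          Nat.prime_dvd_prime_iff_eq hp Nat.prime_five,
          Nat.prime_dvd_prime_iff_eq hp (show Nat.Prime 7 by norm_num)] at h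
        simp only [List.mem_cons, List.not_mem_nil]
        omega
    exact (Finset.card_le_card h_sub).trans (by decide +kernel)
  have h_sum : primePowerSum (g n) ≤ 240 * 2018 :=
    (Finset.sum_le_card_nsmul _ _ _ h_pow).trans (Nat.mul_le_mul_right _ h_card)
  have h_le := le_g (n := n) (m := 1009 ^ 1 * g n) (mul_ne_zero (by norm_num) (g_ne_zero n)) (by
    rw [primePowerSum_prime_pow_mul h_prime one_ne_zero h_not]
    omega)
  have := g_ne_zero n
  omega

theorem eq_of_not_dvd {n q p p' : ℕ} (hn : 500000 < n) (hq : q.Prime) (hqg : q ∣ g n)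
    (hqmax : ∀ r : ℕ, r.Prime → r ∣ g n → r ≤ q) (hp : p.Prime) (hp' : p'.Prime)
    (hpg : ¬ p ∣ g n) (hpg' : ¬ p' ∣ g n) (h_lt : p < p') (h_bound : 10000 * p' < 8357 * q)
    (h_min : ∀ s < p, s.Prime → s ∣ g n) : False := by
  have hq_large := le_largest_prime_of_lt hn hqmax
  have h_sum := lt_add_of_not_dvd hq hqg hp hp' h_lt hpg hpg'
  obtain ⟨d, hd⟩ := Nat.exists_eq_add_of_le h_sum.le
  obtain ⟨s, hs, hds, h_near⟩ := exists_prime_near (b := d) (by omega)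
  obtain ⟨u, hu⟩ := Nat.exists_eq_add_of_le (show p ≤ q by omega)
  obtain ⟨v, hv⟩ := Nat.exists_eq_add_of_le (show p' ≤ q by omega)
  have hu_large : 1643 * q < 10000 * u := by omega
  have hv_large : 1643 * q < 10000 * v := by omega
  have h_uv : 1643 * q * (1643 * q) < 10000 * u * (10000 * v) :=
    Nat.mul_lt_mul'' hu_large hv_large
  have h_eq : p * p' = d * q + u * v := by
    zify at hd hu hv ⊢
    have hu' : (u : ℤ) = q - p := by linarith
    have hv' : (v : ℤ) = q - p' := by linarith
    have hd' : (d : ℤ) = p + p' - q := by linarith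
    rw [hu', hv', hd']
    ring
  have h_prod : s * q < p * p' := by
    rw [h_eq]
    have hd_small : 10000 * d < 6714 * q := by omega
    rcases h_near with h | h
    · nlinarith
    · have h_sq := Nat.mul_le_mul_right q h
      have h_dq := Nat.mul_lt_mul_of_pos_right hd_small hq.pos
      nlinarith
  have hsp : s < p := by
    by_contra! h
    exact absurd h_prod (not_lt.2 (Nat.mul_le_mul h (by omega)))
  exact absurd h_prod (not_lt.2 (mul_le_mul_of_add_le_add hq hs (by omega) hqg
    (h_min s hsp hs) hp hp' h_lt.ne hpg hpg' (by omega)))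

theorem at_most_ten_primes_fail (n : ℕ) (hn : 500000 < n) (q : ℕ)
    (hq : q.Prime) (hqdvd : q ∣ g n)
    (hqmax : ∀ r : ℕ, r.Prime → r ∣ g n → r ≤ q) :
    {p : ℕ | p.Prime ∧ (p : ℝ) < 0.8357 * q ∧ ¬ p ∣ g n}.ncard ≤ 10 ∧
    ∀ p : ℕ, p.Prime → (p : ℝ) < 0.8357 * q → ¬ p ∣ g n →
      ∃ α ∈ [(0 : ℝ), 0.2426, 0.3746, 0.4632, 0.5248, 0.57, 0.6044, 0.6312,
        0.6534, 0.6714], (p : ℝ) ≤ (1 + α) * q / 2 := by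
  refine ⟨?_, fun p _ h _ => ⟨0.6714, by simp, by linarith⟩⟩
  have h_lt : ∀ p : ℕ, (p : ℝ) < 0.8357 * q → 10000 * p < 8357 * q := by
    intro p h
    have : (10000 * p : ℝ) < 8357 * q := by linarith
    exact_mod_cast this
  have h_fin : {p : ℕ | p.Prime ∧ (p : ℝ) < 0.8357 * q ∧ ¬ p ∣ g n}.Finite := by
    refine (Set.finite_lt_nat q).subset fun p hp => ?_
    have := h_lt p hp.2.1
    show p < q
    omega
  refine le_trans ((Set.ncard_le_one h_fin).2 ?_) (by norm_num)
  by_contra! h_ne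
  obtain ⟨a, ha, b, hb, hab⟩ := h_ne
  have h_ex : ∃ p : ℕ, p.Prime ∧ (p : ℝ) < 0.8357 * q ∧ ¬ p ∣ g n := ⟨a, ha⟩
  classical
  obtain ⟨p, hp, h_le⟩ : ∃ p : ℕ, (p.Prime ∧ (p : ℝ) < 0.8357 * q ∧ ¬ p ∣ g n) ∧
      ∀ s : ℕ, s.Prime ∧ (s : ℝ) < 0.8357 * q ∧ ¬ s ∣ g n → p ≤ s :=
    ⟨Nat.find h_ex, Nat.find_spec h_ex, fun s hs => Nat.find_min' h_ex hs⟩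
  obtain ⟨p', hp', h_lt_p'⟩ : ∃ p' : ℕ, (p'.Prime ∧ (p' : ℝ) < 0.8357 * q ∧ ¬ p' ∣ g n) ∧
      p < p' := by
    rcases eq_or_lt_of_le (h_le a ha) with rfl | h
    · exact ⟨b, hb, lt_of_le_of_ne (h_le b hb) hab⟩
    · exact ⟨a, ha, h⟩
  refine eq_of_not_dvd hn hq hqdvd hqmax hp.1 hp'.1 hp.2.2 hp'.2.2 h_lt_p' (h_lt p' hp'.2.1)
    fun s hsp hs => ?_
  by_contra h_not
  exact absurd (h_le s ⟨hs, (Nat.cast_lt.2 hsp).trans hp.2.1, h_not⟩) (not_le.2 hsp)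
end
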